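/- arXiv:2105.13159 — 7 statements merged into one kernel-verified Lean document; each statement's English description precedes it below -/
import Mathlib

section
/- The set of initial data x̄ ∈ (ℝ^n)^N from which there exist more than one Krasovsky solution of the metric bounded-confidence model ẋ = f^m(x) (i.e., two Krasovsky solutions starting at x̄ that differ at some time in a common interval of definition) has zero Lebesgue measure in ℝ^{nN}. -/
open MeasureTheory Set Filter
open scoped Pointwise

noncomputable section

/-- The state space of `N` agents with opinions in `ℝ^n`. -/
abbrev St (n N : ℕ) := Fin N → EuclideanSpace ℝ (Fin n)

/-- The Krasovsky multifunction of a vector field `g`: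
`K g (x) = ⋂_{δ>0} closure (convexHull (g '' B(x,δ)))`. -/
def krasovsky {E : Type*} [NormedAddCommGroup E] [NormedSpace ℝ E] (g : E → E) (x : E) :
    Set E :=
  ⋂ δ > (0:ℝ), closure (convexHull ℝ (g '' Metric.ball x δ))

/-- Krasovsky solution of `ẋ = g(x)` on the set `D`: an absolutely continuous curve
(written in integral form) whose a.e. derivative `v` satisfies `v(s) ∈ K g (x(s))`. -/
def IsKrasovskySolutionOn {E : Type*} [NormedAddCommGroup E] [NormedSpace ℝ E]
    [CompleteSpace E] (g : E → E) (x : ℝ → E) (D : Set ℝ) : Prop :=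
  ∃ v : ℝ → E, LocallyIntegrableOn v D ∧
    (∀ t ∈ D, x t = x 0 + ∫ s in Ioc (0:ℝ) t, v s) ∧
    (∀ᵐ s ∂(volume.restrict D), v s ∈ krasovsky g (x s))

/-- The metric bounded-confidence vector field:
`fᵐᵢ(x) = Σ_{j : ‖x_j - x_i‖ < 1} a(‖x_j - x_i‖)(x_j - x_i)`. -/
def fm {n N : ℕ} (a : ℝ → ℝ) (x : St n N) : St n N :=
  fun i => ∑ j ∈ Finset.univ.filter (fun j => ‖x j - x i‖ < 1),
    a ‖x j - x i‖ • (x j - x i)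

/-! ### The regularised pair interaction -/

section PairForce

variable {E : Type*} [NormedAddCommGroup E] [InnerProductSpace ℝ E] {a : ℝ → ℝ} {K : NNReal}

/-- The pair interaction `a(‖u‖) u`, continued beyond the unit ball without cutoff. -/
def pairForce (a : ℝ → ℝ) (u : E) : E := a (min ‖u‖ 1) • u

open Classical in
/-- The pair interaction `a(‖u‖) u`, cut off outside the open unit ball. -/
def cutForce (a : ℝ → ℝ) (u : E) : E := if ‖u‖ < 1 then pairForce a u else 0

lemma weight_mem_Icc (ha_nonneg : ∀ r : ℝ, 0 ≤ r → 0 ≤ a r) (ha_mono : MonotoneOn a (Set.Ici 0))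
    {r : ℝ} (hr : 0 ≤ r) : 0 ≤ a (min r 1) ∧ a (min r 1) ≤ a 1 :=
  ⟨ha_nonneg _ (by positivity),
    ha_mono (by simpa using hr) (by simp) (min_le_right _ _)⟩

lemma pairForce_neg (u : E) : pairForce a (-u) = -pairForce a u := by
  simp [pairForce]

lemma cutForce_neg (u : E) : cutForce a (-u) = -cutForce a u := by
  unfold cutForce; split_ifs <;> simp_all [pairForce_neg]

lemma norm_pairForce_sub_le (ha_lip : LipschitzOnWith K a (Set.Ici 0))
    (ha_nonneg : ∀ r : ℝ, 0 ≤ r → 0 ≤ a r) (ha_mono : MonotoneOn a (Set.Ici 0)) (u w : E) :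
    ‖pairForce a u - pairForce a w‖ ≤ (a 1 + K) * ‖u - w‖ := by
  wlog h : ‖w‖ ≤ ‖u‖ generalizing u w
  · rw [norm_sub_rev, norm_sub_rev u]
    exact this w u (le_of_not_ge h)
  have e : pairForce a u - pairForce a w
      = a (min ‖u‖ 1) • (u - w) + (a (min ‖u‖ 1) - a (min ‖w‖ 1)) • w := by
    simp only [pairForce]; module
  obtain ⟨h0, h1⟩ := weight_mem_Icc ha_nonneg ha_mono (norm_nonneg u)
  have h2 : |a (min ‖u‖ 1) - a (min ‖w‖ 1)| * ‖w‖ ≤ K * ‖u - w‖ := by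
    rcases le_total ‖w‖ 1 with hw | hw
    · have h3 := ha_lip.dist_le_mul (min ‖u‖ 1) (by simp) (min ‖w‖ 1) (by simp)
      rw [Real.dist_eq, Real.dist_eq] at h3
      have h4 : |min ‖u‖ 1 - min ‖w‖ 1| ≤ ‖u - w‖ :=
        (abs_min_sub_min_le_max _ _ _ _).trans (by simpa using abs_norm_sub_norm_le u w)
      have h5 : (0:ℝ) ≤ K := K.2
      calc _ ≤ (K * |min ‖u‖ 1 - min ‖w‖ 1|) * 1 := by gcongr
        _ ≤ _ := by rw [mul_one]; gcongr
    · rw [min_eq_right (hw.trans h), min_eq_right hw]; simp; positivity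
  rw [e]
  refine (norm_add_le _ _).trans ?_
  rw [norm_smul, norm_smul, Real.norm_eq_abs, Real.norm_eq_abs, abs_of_nonneg h0]
  nlinarith [mul_le_mul_of_nonneg_right h1 (norm_nonneg (u - w))]

lemma norm_pairForce_le (ha_nonneg : ∀ r : ℝ, 0 ≤ r → 0 ≤ a r)
    (ha_mono : MonotoneOn a (Set.Ici 0)) {u : E} (hu : ‖u‖ ≤ 1) : ‖pairForce a u‖ ≤ a 1 := by
  obtain ⟨h0, h1⟩ := weight_mem_Icc ha_nonneg ha_mono (norm_nonneg u)
  rw [pairForce, norm_smul, Real.norm_eq_abs, abs_of_nonneg h0]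
  nlinarith [norm_nonneg u]

lemma norm_cutForce_le (ha_nonneg : ∀ r : ℝ, 0 ≤ r → 0 ≤ a r)
    (ha_mono : MonotoneOn a (Set.Ici 0)) (u : E) : ‖cutForce a u‖ ≤ a 1 := by
  unfold cutForce
  split_ifs with h
  · exact norm_pairForce_le ha_nonneg ha_mono h.le
  · simpa using ha_nonneg 1 zero_le_one

lemma inner_cutForce_sub_le (ha_lip : LipschitzOnWith K a (Set.Ici 0))
    (ha_nonneg : ∀ r : ℝ, 0 ≤ r → 0 ≤ a r) (ha_mono : MonotoneOn a (Set.Ici 0)) (u w : E) :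
    inner ℝ (cutForce a u - cutForce a w) (u - w) ≤ (a 1 + K) * ‖u - w‖ ^ 2 := by
  wlog h : ‖u‖ ≤ ‖w‖ generalizing u w
  · rw [← inner_neg_neg, neg_sub, neg_sub, norm_sub_rev]
    exact this w u (le_of_not_ge h)
  have ha1 := ha_nonneg 1 zero_le_one
  have hK : (0:ℝ) ≤ K := K.2
  by_cases hw : ‖w‖ < 1
  · rw [cutForce, cutForce, if_pos hw, if_pos (h.trans_lt hw)]
    refine (real_inner_le_norm _ _).trans ?_
    nlinarith [norm_pairForce_sub_le ha_lip ha_nonneg ha_mono u w, norm_nonneg (u - w)]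
  · by_cases hu : ‖u‖ < 1
    · rw [cutForce, cutForce, if_neg hw, if_pos hu, sub_zero, pairForce, real_inner_smul_left]
      obtain ⟨h0, h1⟩ := weight_mem_Icc ha_nonneg ha_mono (norm_nonneg u)
      have h2 : 2 * inner ℝ u (u - w) ≤ ‖u - w‖ ^ 2 := by
        rw [norm_sub_sq_real, inner_sub_right, real_inner_self_eq_norm_sq]
        nlinarith [norm_nonneg u]
      nlinarith [sq_nonneg ‖u - w‖, mul_le_mul_of_nonneg_left h2 h0,
        mul_le_mul_of_nonneg_right h1 (sq_nonneg ‖u - w‖)]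
    · rw [cutForce, cutForce, if_neg hw, if_neg hu]; simp; positivity

end PairForce

/-! ### Bounds for the vector field -/

section Field

variable {n N : ℕ} {a : ℝ → ℝ} {K : NNReal}

lemma fm_apply (x : St n N) (i : Fin N) : fm a x i = ∑ j, cutForce a (x j - x i) := by
  classical
  rw [fm, Finset.sum_filter]
  refine Finset.sum_congr rfl fun j _ => ?_
  unfold cutForce pairForce
  split_ifs with h
  · rw [min_eq_left h.le]
  · rfl

lemma norm_fm_le (ha_nonneg : ∀ r : ℝ, 0 ≤ r → 0 ≤ a r)
    (ha_mono : MonotoneOn a (Set.Ici 0)) (x : St n N) : ‖fm a x‖ ≤ N * a 1 := by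
  have ha1 := ha_nonneg 1 zero_le_one
  refine (pi_norm_le_iff_of_nonneg (by positivity)).2 fun i => ?_
  rw [fm_apply]
  refine (norm_sum_le _ _).trans ?_
  simpa using Finset.sum_le_card_nsmul Finset.univ (fun j => ‖cutForce a (x j - x i)‖) (a 1)
    fun j _ => norm_cutForce_le ha_nonneg ha_mono _

lemma fm_one_sided (ha_lip : LipschitzOnWith K a (Set.Ici 0))
    (ha_nonneg : ∀ r : ℝ, 0 ≤ r → 0 ≤ a r) (ha_mono : MonotoneOn a (Set.Ici 0)) (x y : St n N) :
    -(2 * N * (a 1 + K)) * ∑ i, ‖x i - y i‖ ^ 2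
      ≤ ∑ i, inner ℝ (fm a x i - fm a y i) (x i - y i) := by
  set e : Fin N → EuclideanSpace ℝ (Fin n) := fun i => x i - y i with he
  set Φ : Fin N → Fin N → EuclideanSpace ℝ (Fin n) :=
    fun i j => cutForce a (x j - x i) - cutForce a (y j - y i) with hΦ
  have hanti : ∀ i j, Φ j i = -Φ i j := fun i j => by
    simp only [hΦ]
    rw [← neg_sub (x j), ← neg_sub (y j), cutForce_neg, cutForce_neg]; abel
  have h1 : ∑ i, inner ℝ (fm a x i - fm a y i) (x i - y i) = ∑ i, ∑ j, inner ℝ (Φ i j) (e i) := by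
    refine Finset.sum_congr rfl fun i _ => ?_
    rw [fm_apply, fm_apply, ← Finset.sum_sub_distrib, sum_inner]
  have h2 : ∑ i, ∑ j, inner ℝ (Φ i j) (e i) = -∑ i, ∑ j, inner ℝ (Φ i j) (e j) := by
    rw [Finset.sum_comm, ← Finset.sum_neg_distrib]
    refine Finset.sum_congr rfl fun i _ => ?_
    rw [← Finset.sum_neg_distrib]
    refine Finset.sum_congr rfl fun j _ => ?_
    rw [hanti, inner_neg_left]
  have h3 : ∀ i j, inner ℝ (Φ i j) (e j) - inner ℝ (Φ i j) (e i)
      ≤ (a 1 + K) * (2 * (‖e i‖ ^ 2 + ‖e j‖ ^ 2)) := fun i j => by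
    have h4 := inner_cutForce_sub_le ha_lip ha_nonneg ha_mono (x j - x i) (y j - y i)
    have h5 : x j - x i - (y j - y i) = e j - e i := by simp only [he]; abel
    rw [h5, inner_sub_right] at h4
    have h6 : ‖e j - e i‖ ^ 2 ≤ 2 * (‖e i‖ ^ 2 + ‖e j‖ ^ 2) := by
      have := parallelogram_law_with_norm ℝ (e j) (e i)
      nlinarith [norm_nonneg (e j + e i)]
    have : 0 ≤ a 1 + K := add_nonneg (ha_nonneg 1 zero_le_one) K.2
    exact h4.trans (by gcongr)
  have h4 : ∑ i, ∑ j, (inner ℝ (Φ i j) (e j) - inner ℝ (Φ i j) (e i))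
      ≤ ∑ i, ∑ j, (a 1 + K) * (2 * (‖e i‖ ^ 2 + ‖e j‖ ^ 2)) :=
    Finset.sum_le_sum fun i _ => Finset.sum_le_sum fun j _ => h3 i j
  have h5 : ∑ i : Fin N, ∑ j : Fin N, (a 1 + K) * (2 * (‖e i‖ ^ 2 + ‖e j‖ ^ 2))
      = 4 * N * (a 1 + K) * ∑ i, ‖e i‖ ^ 2 := by
    simp only [← Finset.mul_sum, Finset.sum_add_distrib, Finset.sum_const, Finset.card_univ,
      Fintype.card_fin, nsmul_eq_mul]
    ring
  simp only [Finset.sum_sub_distrib] at h4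
  rw [h1]
  linarith

end Field

/-! ### Krasovsky velocities -/

section Krasovsky

lemma krasovsky_subset {E : Type*} [NormedAddCommGroup E] [NormedSpace ℝ E] {g : E → E} {x : E}
    {C : Set E} (hC : IsClosed C) (hconv : Convex ℝ C)
    (h : ∀ᶠ z in nhds x, g z ∈ C) : krasovsky g x ⊆ C := by
  obtain ⟨δ, hδ, hb⟩ := Metric.eventually_nhds_iff_ball.1 h
  refine (iInter₂_subset δ hδ).trans (closure_minimal (convexHull_min ?_ hconv) hC)
  rintro _ ⟨z, hz, rfl⟩
  exact hb z hz

lemma eq_of_mem_krasovsky {E : Type*} [NormedAddCommGroup E] [NormedSpace ℝ E] {g h : E → E}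
    {x v : E} (hh : ContinuousAt h x) (hgh : ∀ᶠ z in nhds x, g z = h z)
    (hv : v ∈ krasovsky g x) : v = h x := by
  refine eq_of_forall_dist_le fun ε hε => ?_
  refine krasovsky_subset (C := Metric.closedBall (h x) ε) Metric.isClosed_closedBall
    (convex_closedBall _ _) ?_ hv
  filter_upwards [hgh, hh.eventually (Metric.closedBall_mem_nhds _ hε)] with z hz hz'
  rwa [hz]

variable {n N : ℕ} {a : ℝ → ℝ} {K : NNReal}

lemma norm_le_of_mem_krasovsky_fm (ha_nonneg : ∀ r : ℝ, 0 ≤ r → 0 ≤ a r)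
    (ha_mono : MonotoneOn a (Set.Ici 0)) {x v : St n N} (hv : v ∈ krasovsky (fm a) x) :
    ‖v‖ ≤ N * a 1 := by
  simpa using krasovsky_subset (C := Metric.closedBall 0 (N * a 1)) Metric.isClosed_closedBall
    (convex_closedBall _ _) (.of_forall fun z => by
      simpa using norm_fm_le ha_nonneg ha_mono z) hv

lemma abs_sum_inner_le (u w : St n N) : |∑ i, inner ℝ (u i) (w i)| ≤ N * (‖u‖ * ‖w‖) := by
  refine (Finset.abs_sum_le_sum_abs _ _).trans ?_
  simpa using Finset.sum_le_card_nsmul Finset.univ (fun i => |inner ℝ (u i) (w i)|) (‖u‖ * ‖w‖)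
    fun i _ => (abs_real_inner_le_norm _ _).trans (by
      gcongr <;> exact norm_le_pi_norm _ i)

lemma convex_setOf_le_sum_inner_sub (m : ℝ) (w e : St n N) :
    Convex ℝ {v : St n N | m ≤ ∑ i, inner ℝ (v i - w i) (e i)} := by
  have h : {v : St n N | m ≤ ∑ i, inner ℝ (v i - w i) (e i)}
      = {v : St n N | m + ∑ i, inner ℝ (w i) (e i) ≤ ∑ i, inner ℝ (v i) (e i)} := by
    ext v
    simp only [mem_ofPred_eq, inner_sub_left, Finset.sum_sub_distrib, le_sub_iff_add_le]
  rw [h]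
  refine convex_halfSpace_ge (𝕜 := ℝ) ⟨fun p q => ?_, fun c p => ?_⟩ _
  · simp only [Pi.add_apply, inner_add_left, Finset.sum_add_distrib]
  · simp only [Pi.smul_apply, real_inner_smul_left, Finset.mul_sum, smul_eq_mul]

lemma isClosed_setOf_le_sum_inner_sub (m : ℝ) (w e : St n N) :
    IsClosed {v : St n N | m ≤ ∑ i, inner ℝ (v i - w i) (e i)} :=
  isClosed_le continuous_const (by fun_prop)

lemma fm_one_sided_perturbed (ha_lip : LipschitzOnWith K a (Set.Ici 0))
    (ha_nonneg : ∀ r : ℝ, 0 ≤ r → 0 ≤ a r) (ha_mono : MonotoneOn a (Set.Ici 0))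
    (x y p q : St n N) :
    -(2 * N * (a 1 + K)) * ∑ i, ‖p i - q i‖ ^ 2
        - N * ((N * a 1 + N * a 1) * ‖(x - y) - (p - q)‖)
      ≤ ∑ i, inner ℝ (fm a p i - fm a q i) (x i - y i) := by
  have h1 := fm_one_sided ha_lip ha_nonneg ha_mono p q
  have h2 := (abs_le.1 (abs_sum_inner_le (fm a p - fm a q) ((x - y) - (p - q)))).1
  have h3 : ‖fm a p - fm a q‖ ≤ N * a 1 + N * a 1 := (norm_sub_le _ _).trans
    (add_le_add (norm_fm_le ha_nonneg ha_mono _) (norm_fm_le ha_nonneg ha_mono _))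
  have h4 : (N:ℝ) * (‖fm a p - fm a q‖ * ‖(x - y) - (p - q)‖)
      ≤ N * ((N * a 1 + N * a 1) * ‖(x - y) - (p - q)‖) := by gcongr
  have h5 : ∑ i, inner ℝ (fm a p i - fm a q i) (x i - y i)
      = ∑ i, inner ℝ (fm a p i - fm a q i) (p i - q i)
        + ∑ i, inner ℝ ((fm a p - fm a q) i) (((x - y) - (p - q)) i) := by
    rw [← Finset.sum_add_distrib]
    refine Finset.sum_congr rfl fun i _ => ?_
    simp only [Pi.sub_apply]
    rw [← inner_add_right]; simp
  linarith

lemma krasovsky_fm_one_sided (ha_lip : LipschitzOnWith K a (Set.Ici 0))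
    (ha_nonneg : ∀ r : ℝ, 0 ≤ r → 0 ≤ a r) (ha_mono : MonotoneOn a (Set.Ici 0))
    {x y v w : St n N} (hv : v ∈ krasovsky (fm a) x) (hw : w ∈ krasovsky (fm a) y) :
    -(2 * N * (a 1 + K)) * ∑ i, ‖x i - y i‖ ^ 2 ≤ ∑ i, inner ℝ (v i - w i) (x i - y i) := by
  refine le_of_forall_lt_imp_le_of_dense fun m hm => ?_
  set G : St n N × St n N → ℝ := fun p =>
      -(2 * N * (a 1 + K)) * ∑ i, ‖p.1 i - p.2 i‖ ^ 2
        - N * ((N * a 1 + N * a 1) * ‖(x - y) - (p.1 - p.2)‖) with hG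
  have hcont : Continuous G := by fun_prop
  have hm' : m < G (x, y) := by simpa [hG] using hm
  have hev : ∀ᶠ p : St n N × St n N in nhds (x, y),
      m ≤ ∑ i, inner ℝ (fm a p.1 i - fm a p.2 i) (x i - y i) := by
    filter_upwards [hcont.continuousAt.eventually (lt_mem_nhds hm')] with p hp
    exact hp.le.trans (fm_one_sided_perturbed ha_lip ha_nonneg ha_mono x y p.1 p.2)
  refine krasovsky_subset (isClosed_setOf_le_sum_inner_sub m w (x - y))
    (convex_setOf_le_sum_inner_sub m w (x - y)) ?_ hv
  filter_upwards [hev.curry_nhds] with p hp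
  have hswap : ∀ q : St n N, ∑ i, inner ℝ (q i - fm a p i) ((y - x) i)
      = ∑ i, inner ℝ (fm a p i - q i) (x i - y i) := fun q => by
    refine Finset.sum_congr rfl fun i _ => ?_
    rw [← inner_neg_neg, neg_sub, Pi.sub_apply, neg_sub]
  have := krasovsky_subset (isClosed_setOf_le_sum_inner_sub m (fm a p) (y - x))
    (convex_setOf_le_sum_inner_sub m (fm a p) (y - x))
    (by filter_upwards [hp] with q hq; rwa [hswap]) hw
  rwa [mem_ofPred_eq, hswap] at this

end Krasovsky

lemma norm_sq_le_sum {n N : ℕ} (u : St n N) : ‖u‖ ^ 2 ≤ ∑ i, ‖u i‖ ^ 2 := by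
  rw [← Real.le_sqrt (norm_nonneg _) (by positivity)]
  refine (pi_norm_le_iff_of_nonneg (Real.sqrt_nonneg _)).2 fun i => Real.le_sqrt_of_sq_le ?_
  exact Finset.single_le_sum (f := fun i => ‖u i‖ ^ 2) (fun _ _ => by positivity) (Finset.mem_univ i)

lemma sum_norm_sq_le {n N : ℕ} (u : St n N) : ∑ i, ‖u i‖ ^ 2 ≤ N * ‖u‖ ^ 2 := by
  simpa using Finset.sum_le_card_nsmul Finset.univ (fun i => ‖u i‖ ^ 2) (‖u‖ ^ 2)
    fun i _ => by gcongr; exact norm_le_pi_norm _ i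

/-! ### Growth of absolutely continuous functions -/

section Growth

lemma AbsolutelyContinuousOnInterval.le_of_ae_deriv_nonneg {D : ℝ → ℝ} {s t : ℝ} (hst : s ≤ t)
    (hD : AbsolutelyContinuousOnInterval D s t)
    (h : ∀ᵐ r, r ∈ Ioo s t → ∀ d, HasDerivAt D d r → 0 ≤ d) : D s ≤ D t := by
  have h1 := hD.integral_deriv_eq_sub
  have h2 : 0 ≤ ∫ r in s..t, deriv D r := by
    rw [intervalIntegral.integral_of_le hst, integral_Ioc_eq_integral_Ioo]
    refine setIntegral_nonneg_of_ae_restrict ?_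
    rw [EventuallyLE, ae_restrict_iff' measurableSet_Ioo]
    filter_upwards [h] with r hr hrm
    by_cases hd : DifferentiableAt ℝ D r
    · exact hr hrm _ hd.hasDerivAt
    · simp [deriv_zero_of_not_differentiableAt hd]
  linarith

lemma AbsolutelyContinuousOnInterval.exp_mul_le_of_ae_deriv_ge {D : ℝ → ℝ} {s t c : ℝ}
    (hst : s ≤ t) (hD : AbsolutelyContinuousOnInterval D s t)
    (h : ∀ᵐ r, r ∈ Ioo s t → ∀ d, HasDerivAt D d r → c * D r ≤ d) :
    Real.exp (c * (t - s)) * D s ≤ D t := by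
  have hexp : ∀ r : ℝ, HasDerivAt (fun r => Real.exp (-c * r)) (Real.exp (-c * r) * -c) r :=
    fun r => by simpa using ((hasDerivAt_id r).const_mul (-c)).exp
  have hAC : AbsolutelyContinuousOnInterval (fun r => Real.exp (-c * r)) s t :=
    ContDiffOn.absolutelyContinuousOnInterval (ContDiff.contDiffOn (by fun_prop))
  have h1 := (hAC.mul hD).le_of_ae_deriv_nonneg hst (by
    filter_upwards [h] with r hr hrm d hd
    have hpos := Real.exp_pos (-c * r)
    have h3 : HasDerivAt D ((Real.exp (-c * r))⁻¹ * (d + c * Real.exp (-c * r) * D r)) r := by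
      have h4 := ((hexp r).inv hpos.ne').mul hd
      have h5 : (fun r => Real.exp (-c * r))⁻¹ * ((fun r => Real.exp (-c * r)) * D) = D := by
        ext u; simp
      rw [h5] at h4
      refine h4.congr_deriv ?_
      simp only [Pi.inv_apply, Pi.mul_apply]
      field_simp
      ring
    have h6 := hr hrm _ h3
    rw [← div_eq_inv_mul, le_div_iff₀ hpos] at h6
    linarith)
  simp only [Pi.mul_apply] at h1
  have h7 : Real.exp (c * (t - s)) = Real.exp (c * t) * Real.exp (-c * s) := by
    rw [← Real.exp_add]; ring_nf
  calc _ = Real.exp (c * t) * (Real.exp (-c * s) * D s) := by rw [h7]; ring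
    _ ≤ Real.exp (c * t) * (Real.exp (-c * t) * D t) := by gcongr
    _ = D t := by rw [← mul_assoc, ← Real.exp_add]; simp

variable {n N : ℕ}

lemma absolutelyContinuousOnInterval_sum {ι : Type*} (S : Finset ι) {f : ι → ℝ → ℝ} {s t : ℝ}
    (h : ∀ i ∈ S, AbsolutelyContinuousOnInterval (f i) s t) :
    AbsolutelyContinuousOnInterval (fun r => ∑ i ∈ S, f i r) s t := by
  classical
  induction S using Finset.induction_on with
  | empty =>
    simpa using ContDiffOn.absolutelyContinuousOnInterval
      (contDiff_const (c := (0:ℝ))).contDiffOn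
  | insert i S hi ih =>
    simp only [Finset.sum_insert hi]
    exact (h i (by simp)).add (ih fun j hj => h j (by simp [hj]))

lemma absolutelyContinuousOnInterval_norm_sq {E : Type*} [NormedAddCommGroup E] {x : ℝ → E}
    {C s t : ℝ} (h : ∀ p ∈ uIcc s t, ∀ q ∈ uIcc s t, ‖x p - x q‖ ≤ C * |p - q|) :
    AbsolutelyContinuousOnInterval (fun r => ‖x r‖ ^ 2) s t := by
  have h1 : LipschitzOnWith C.toNNReal (fun r => ‖x r‖) (uIcc s t) :=
    LipschitzOnWith.of_dist_le_mul fun p hp q hq => by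
      rw [Real.dist_eq, Real.dist_eq]
      exact (abs_norm_sub_norm_le _ _).trans ((h p hp q hq).trans
        (by gcongr; exact Real.le_coe_toNNReal C))
  have h2 := h1.absolutelyContinuousOnInterval
  have h3 : (fun r => ‖x r‖ ^ 2) = (fun r => ‖x r‖) * fun r => ‖x r‖ := by ext; simp [sq]
  exact h3 ▸ h2.mul h2

end Growth

/-! ### Solutions with bounded speed -/

section Solutions

/-- A curve with speed at most `F` whose derivative is a.e. a Krasovsky velocity of `g`. -/
structure IsBoundedSol {E : Type*} [NormedAddCommGroup E] [NormedSpace ℝ E] (g : E → E) (F : ℝ)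
    (x : ℝ → E) (s t : ℝ) : Prop where
  speed : ∀ p ∈ Icc s t, ∀ q ∈ Icc s t, ‖x p - x q‖ ≤ F * |p - q|
  ae_deriv : ∀ᵐ r, r ∈ Ioo s t → ∃ v ∈ krasovsky g (x r), HasDerivAt x v r

lemma IsBoundedSol.mono {E : Type*} [NormedAddCommGroup E] [NormedSpace ℝ E] {g : E → E} {F : ℝ}
    {x : ℝ → E} {s t s' t' : ℝ} (h : IsBoundedSol g F x s t) (hs : s ≤ s') (ht : t' ≤ t) :
    IsBoundedSol g F x s' t' where
  speed p hp q hq := h.speed p (Icc_subset_Icc hs ht hp) q (Icc_subset_Icc hs ht hq)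
  ae_deriv := by
    filter_upwards [h.ae_deriv] with r hr hrm using hr (Ioo_subset_Ioo hs ht hrm)

lemma IsKrasovskySolutionOn.isBoundedSol {E : Type*} [NormedAddCommGroup E] [NormedSpace ℝ E]
    [CompleteSpace E] {g : E → E} {F : ℝ} (hF : ∀ x, ∀ v ∈ krasovsky g x, ‖v‖ ≤ F) {x : ℝ → E}
    {T : ℝ} (hT : 0 ≤ T) (h : IsKrasovskySolutionOn g x (Icc 0 T)) : IsBoundedSol g F x 0 T := by
  obtain ⟨v, hv, hx, hvK⟩ := h
  have hint : IntervalIntegrable v volume 0 T :=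
    (intervalIntegrable_iff_integrableOn_Icc_of_le hT).2
      (hv.integrableOn_isCompact isCompact_Icc)
  have hx' : ∀ t ∈ Icc 0 T, x t = x 0 + ∫ s in (0:ℝ)..t, v s := fun t ht => by
    rw [intervalIntegral.integral_of_le ht.1]; exact hx t ht
  rw [ae_restrict_iff' measurableSet_Icc] at hvK
  constructor
  · intro p hp q hq
    have hsub : ∀ r ∈ Icc 0 T, IntervalIntegrable v volume 0 r := fun r hr =>
      hint.mono_set (by rw [uIcc_of_le hr.1, uIcc_of_le hT]; exact Icc_subset_Icc_right hr.2)
    rw [hx' p hp, hx' q hq, add_sub_add_left_eq_sub,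
      intervalIntegral.integral_interval_sub_left (hsub p hp) (hsub q hq)]
    refine intervalIntegral.norm_integral_le_of_norm_le_const_ae ?_
    filter_upwards [hvK] with r hr hrm
    refine hF _ _ (hr ?_)
    exact uIcc_subset_Icc hq hp (uIoc_subset_uIcc hrm)
  · filter_upwards [hint.ae_hasDerivAt_integral, hvK] with r hr hrK hrm
    refine ⟨v r, hrK (Ioo_subset_Icc_self hrm), ?_⟩
    rw [uIcc_of_le hT] at hr
    refine ((hr (Ioo_subset_Icc_self hrm) 0 (left_mem_Icc.2 hT)).const_add (x 0)).congr_of_eventuallyEq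
      ?_
    filter_upwards [Ioo_mem_nhds hrm.1 hrm.2] with t ht
    exact hx' t (Ioo_subset_Icc_self ht)

variable {n N : ℕ} {F : ℝ} {x y : ℝ → St n N} {s t : ℝ}

lemma absolutelyContinuousOnInterval_dist_sq {g : St n N → St n N} (hst : s ≤ t)
    (hx : IsBoundedSol g F x s t) (hy : IsBoundedSol g F y s t) :
    AbsolutelyContinuousOnInterval (fun r => ∑ i, ‖x r i - y r i‖ ^ 2) s t := by
  refine absolutelyContinuousOnInterval_sum _ fun i _ =>
    absolutelyContinuousOnInterval_norm_sq (C := 2 * F) fun p hp q hq => ?_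
  rw [uIcc_of_le hst] at hp hq
  have h1 := (norm_le_pi_norm (x p - x q) i).trans (hx.speed p hp q hq)
  have h2 := (norm_le_pi_norm (y p - y q) i).trans (hy.speed p hp q hq)
  have h3 : x p i - y p i - (x q i - y q i) = (x p - x q) i - (y p - y q) i := by
    simp only [Pi.sub_apply]; abel
  rw [h3]
  exact (norm_sub_le _ _).trans (by linarith)

lemma hasDerivAt_dist_sq {v w : St n N} {r : ℝ} (hx : HasDerivAt x v r) (hy : HasDerivAt y w r) :
    HasDerivAt (fun r => ∑ i, ‖x r i - y r i‖ ^ 2)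
      (2 * ∑ i, inner ℝ (v i - w i) (x r i - y r i)) r := by
  rw [Finset.mul_sum]
  refine HasDerivAt.fun_sum fun i _ => ?_
  convert! (((hasDerivAt_pi.1 hx i).sub (hasDerivAt_pi.1 hy i)).norm_sq) using 1
  rw [real_inner_comm]; rfl

lemma IsBoundedSol.backward_dist_sq_le {a : ℝ → ℝ} {K : NNReal}
    (ha_lip : LipschitzOnWith K a (Set.Ici 0))
    (ha_nonneg : ∀ r : ℝ, 0 ≤ r → 0 ≤ a r) (ha_mono : MonotoneOn a (Set.Ici 0)) (hst : s ≤ t)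
    (hx : IsBoundedSol (fm a) F x s t) (hy : IsBoundedSol (fm a) F y s t) :
    ∑ i, ‖x s i - y s i‖ ^ 2
      ≤ Real.exp (4 * N * (a 1 + K) * (t - s)) * ∑ i, ‖x t i - y t i‖ ^ 2 := by
  have h1 := (absolutelyContinuousOnInterval_dist_sq hst hx hy).exp_mul_le_of_ae_deriv_ge
    (c := -(4 * N * (a 1 + K))) hst (by
      filter_upwards [hx.ae_deriv, hy.ae_deriv] with r hxr hyr hr d hd
      obtain ⟨v, hv, hv'⟩ := hxr hr
      obtain ⟨w, hw, hw'⟩ := hyr hr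
      rw [hd.unique (hasDerivAt_dist_sq hv' hw')]
      have := krasovsky_fm_one_sided ha_lip ha_nonneg ha_mono hv hw
      linarith)
  rw [neg_mul, Real.exp_neg, ← div_eq_inv_mul, div_le_iff₀ (Real.exp_pos _)] at h1
  linarith

lemma IsBoundedSol.eq_of_ae_eq_lipschitz {g h : St n N → St n N} {L : NNReal}
    (hh : LipschitzWith L h) (hst : s ≤ t)
    (hx : IsBoundedSol g F x s t) (hy : IsBoundedSol g F y s t)
    (hxh : ∀ r ∈ Ioo s t, ∀ v ∈ krasovsky g (x r), v = h (x r))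
    (hyh : ∀ r ∈ Ioo s t, ∀ v ∈ krasovsky g (y r), v = h (y r)) (h0 : x s = y s) : x t = y t := by
  have h1 := (absolutelyContinuousOnInterval_dist_sq hst hx hy).neg.exp_mul_le_of_ae_deriv_ge
    (c := 2 * (N * L)) hst (by
      filter_upwards [hx.ae_deriv, hy.ae_deriv] with r hxr hyr hr d hd
      obtain ⟨v, hv, hv'⟩ := hxr hr
      obtain ⟨w, hw, hw'⟩ := hyr hr
      rw [hd.unique (hasDerivAt_dist_sq hv' hw').neg, hxh r hr v hv, hyh r hr w hw]
      have h2 := (abs_le.1 (abs_sum_inner_le (h (x r) - h (y r)) (x r - y r))).2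
      have h3 := hh.dist_le_mul (x r) (y r)
      rw [dist_eq_norm, dist_eq_norm] at h3
      have h4 : ‖x r - y r‖ ^ 2 ≤ ∑ i, ‖x r i - y r i‖ ^ 2 := norm_sq_le_sum (x r - y r)
      have h5 : (N:ℝ) * (‖h (x r) - h (y r)‖ * ‖x r - y r‖)
          ≤ N * (L * ∑ i, ‖x r i - y r i‖ ^ 2) := by
        refine mul_le_mul_of_nonneg_left ?_ (by positivity)
        calc _ ≤ L * ‖x r - y r‖ * ‖x r - y r‖ := by gcongr
          _ = L * ‖x r - y r‖ ^ 2 := by ring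
          _ ≤ _ := by gcongr
      simp only [Pi.sub_apply, Pi.neg_apply] at h2 ⊢
      linarith)
  simp only [Pi.neg_apply, h0, sub_self] at h1
  have h2 : ∑ i, ‖x t i - y t i‖ ^ 2 ≤ 0 := by simpa using h1
  have h3 : ‖x t - y t‖ ^ 2 ≤ 0 := (norm_sq_le_sum (x t - y t)).trans h2
  have h4 : ‖x t - y t‖ = 0 := by nlinarith [norm_nonneg (x t - y t)]
  exact sub_eq_zero.1 (norm_eq_zero.1 h4)

end Solutions

/-! ### Vector fields with frozen interaction pattern -/

section Frozen

variable {n N : ℕ} {a : ℝ → ℝ} {K : NNReal}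

open Classical in
/-- The interaction field in which agent `i` sees agent `j` exactly if `P i j`. -/
def frozenField (a : ℝ → ℝ) (P : Fin N → Fin N → Prop) (x : St n N) : St n N :=
  fun i => ∑ j, if P i j then pairForce a (x j - x i) else 0

lemma frozenField_lipschitz (ha_lip : LipschitzOnWith K a (Set.Ici 0))
    (ha_nonneg : ∀ r : ℝ, 0 ≤ r → 0 ≤ a r) (ha_mono : MonotoneOn a (Set.Ici 0))
    (P : Fin N → Fin N → Prop) :
    LipschitzWith (2 * N * (a 1 + K)).toNNReal (frozenField (n := n) a P) := by
  classical
  have h0 : 0 ≤ a 1 + K := add_nonneg (ha_nonneg 1 zero_le_one) K.2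
  refine LipschitzWith.of_dist_le_mul fun x y => ?_
  rw [Real.coe_toNNReal _ (by positivity), dist_eq_norm, dist_eq_norm]
  refine (pi_norm_le_iff_of_nonneg (by positivity)).2 fun i => ?_
  have h1 : ∀ j, ‖(if P i j then pairForce a (x j - x i) else 0)
      - (if P i j then pairForce a (y j - y i) else 0)‖ ≤ 2 * (a 1 + K) * ‖x - y‖ := fun j => by
    split_ifs
    · refine (norm_pairForce_sub_le ha_lip ha_nonneg ha_mono _ _).trans ?_
      have h2 : x j - x i - (y j - y i) = (x - y) j - (x - y) i := by
        simp only [Pi.sub_apply]; abel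
      have h3 : ‖x j - x i - (y j - y i)‖ ≤ 2 * ‖x - y‖ := by
        rw [h2]
        refine (norm_sub_le _ _).trans ?_
        linarith [norm_le_pi_norm (x - y) j, norm_le_pi_norm (x - y) i]
      nlinarith
    · simp; positivity
  rw [Pi.sub_apply, frozenField, frozenField, ← Finset.sum_sub_distrib]
  refine (norm_sum_le _ _).trans ((Finset.sum_le_sum fun j _ => h1 j).trans_eq ?_)
  simp; ring

lemma fm_eq_frozenField {P : Fin N → Fin N → Prop} {x : St n N}
    (h : ∀ k l, k ≠ l → (P k l ↔ ‖x l - x k‖ < 1)) : fm a x = frozenField a P x := by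
  classical
  ext1 i
  rw [fm_apply, frozenField]
  refine Finset.sum_congr rfl fun j _ => ?_
  rcases eq_or_ne i j with rfl | hij
  · simp [cutForce, pairForce]
  · simp only [cutForce, h i j hij]

/-- The interaction pattern at `z`, in which agents at distance exactly one interact
if and only if `c` is true. -/
def pattern (z : St n N) (c : Bool) (k l : Fin N) : Prop :=
  ‖z l - z k‖ < 1 ∨ (c = true ∧ ‖z l - z k‖ = 1)

lemma norm_frozenField_pattern_le (ha_nonneg : ∀ r : ℝ, 0 ≤ r → 0 ≤ a r)
    (ha_mono : MonotoneOn a (Set.Ici 0)) (z : St n N) (c : Bool) :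
    ‖frozenField a (pattern z c) z‖ ≤ N * a 1 := by
  classical
  have ha1 := ha_nonneg 1 zero_le_one
  refine (pi_norm_le_iff_of_nonneg (by positivity)).2 fun i => (norm_sum_le _ _).trans ?_
  refine (Finset.sum_le_card_nsmul Finset.univ _ (a 1) fun j _ => ?_).trans_eq (by simp)
  split_ifs with h
  · exact norm_pairForce_le ha_nonneg ha_mono (h.elim le_of_lt fun h => h.2.le)
  · simpa using ha1

/-- The pairs other than `{i, j}` are at distance different from one both at `z` and at `x`,
and on the same side of one. -/
def SameSide (z : St n N) (i j : Fin N) (x : St n N) : Prop :=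
  ∀ k l, k ≠ l → ¬((k = i ∧ l = j) ∨ (k = j ∧ l = i)) →
    (‖z l - z k‖ < 1 ∧ ‖x l - x k‖ < 1) ∨ (1 < ‖z l - z k‖ ∧ 1 < ‖x l - x k‖)

lemma isOpen_setOf_sameSide (z : St n N) (i j : Fin N) : IsOpen {x | SameSide z i j x} := by
  simp only [SameSide, ofPred_forall]
  refine isOpen_iInter_of_finite fun k => isOpen_iInter_of_finite fun l =>
    isOpen_iInter_of_finite fun _ => isOpen_iInter_of_finite fun _ => ?_
  refine IsOpen.union ?_ ?_
  · exact isOpen_const.and (isOpen_lt (by fun_prop) continuous_const)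
  · exact isOpen_const.and (isOpen_lt continuous_const (by fun_prop))

/-- The sign of `‖x i - x j‖ ^ 2 - 1` that belongs to the interaction status `c`. -/
def sideSign (c : Bool) : ℝ := if c then -1 else 1

lemma abs_sideSign_mul (c : Bool) (r : ℝ) : |sideSign c * r| = |r| := by
  cases c <;> simp [sideSign]

lemma exists_sideSign_mul_eq_abs (r : ℝ) : ∃ c, sideSign c * r = |r| := by
  rcases le_total 0 r with h | h
  · exact ⟨false, by simp [sideSign, abs_of_nonneg h]⟩
  · exact ⟨true, by simp [sideSign, abs_of_nonpos h]⟩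

variable {z x v : St n N} {i j : Fin N} {c : Bool}

lemma fm_eq_frozenField_pattern (hz : ‖z i - z j‖ = 1) (hx : SameSide z i j x)
    (h : (c = true ∧ ‖x i - x j‖ < 1) ∨ (c = false ∧ 1 ≤ ‖x i - x j‖)) :
    fm a x = frozenField a (pattern z c) x := by
  refine fm_eq_frozenField fun k l hkl => ?_
  by_cases hp : (k = i ∧ l = j) ∨ (k = j ∧ l = i)
  · have e : ∀ w : St n N, ‖w l - w k‖ = ‖w i - w j‖ := fun w => by
      rcases hp with ⟨rfl, rfl⟩ | ⟨rfl, rfl⟩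
      · exact norm_sub_rev _ _
      · rfl
    rw [pattern, e, e, hz]
    rcases h with ⟨rfl, h⟩ | ⟨rfl, h⟩
    · simp [h]
    · simp [h]
  · rcases hx k l hkl hp with ⟨h1, h2⟩ | ⟨h1, h2⟩
    · simp [pattern, h1, h2]
    · simp [pattern, h1.not_gt, h2.not_gt, h1.ne']

lemma fm_eq_or (hz : ‖z i - z j‖ = 1) (hx : SameSide z i j x) :
    ∃ c, fm a x = frozenField a (pattern z c) x := by
  rcases lt_or_ge ‖x i - x j‖ 1 with h | h
  · exact ⟨true, fm_eq_frozenField_pattern hz hx (.inl ⟨rfl, h⟩)⟩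
  · exact ⟨false, fm_eq_frozenField_pattern hz hx (.inr ⟨rfl, h⟩)⟩

lemma eq_frozenField_of_mem_krasovsky (ha_lip : LipschitzOnWith K a (Set.Ici 0))
    (ha_nonneg : ∀ r : ℝ, 0 ≤ r → 0 ≤ a r) (ha_mono : MonotoneOn a (Set.Ici 0))
    (hz : ‖z i - z j‖ = 1) (hx : SameSide z i j x)
    (hside : 0 < sideSign c * (‖x i - x j‖ ^ 2 - 1)) (hv : v ∈ krasovsky (fm a) x) :
    v = frozenField a (pattern z c) x := by
  refine eq_of_mem_krasovsky
    (frozenField_lipschitz ha_lip ha_nonneg ha_mono _).continuous.continuousAt ?_ hv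
  have h1 : ∀ᶠ w : St n N in nhds x, 0 < sideSign c * (‖w i - w j‖ ^ 2 - 1) :=
    (isOpen_lt continuous_const (by fun_prop)).mem_nhds hside
  filter_upwards [(isOpen_setOf_sameSide z i j).mem_nhds hx, h1] with w hw hpos
  refine fm_eq_frozenField_pattern hz hw ?_
  cases c
  · refine .inr ⟨rfl, ?_⟩
    simp only [sideSign] at hpos
    norm_num at hpos
    exact hpos.le
  · refine .inl ⟨rfl, ?_⟩
    norm_num [sideSign] at hpos
    exact hpos

/-- Half the derivative of `‖x i - x j‖ ^ 2` along a field with frozen pattern. -/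
def flux (a : ℝ → ℝ) (P : Fin N → Fin N → Prop) (i j : Fin N) (x : St n N) : ℝ :=
  inner ℝ (x i - x j) (frozenField a P x i - frozenField a P x j)

lemma flux_pattern_true_le (ha_nonneg : ∀ r : ℝ, 0 ≤ r → 0 ≤ a r) (hij : i ≠ j)
    (hz : ‖z i - z j‖ = 1) (h : SameSide z i j z) :
    flux a (pattern z true) i j z ≤ flux a (pattern z false) i j z := by
  classical
  have key : ∀ k m, ((k = i ∧ m = j) ∨ (k = j ∧ m = i)) →
      frozenField a (pattern z true) z k
        = frozenField a (pattern z false) z k + a 1 • (z m - z k) := fun k m hkm => by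
    have hzk : ‖z m - z k‖ = 1 := by
      rcases hkm with ⟨rfl, rfl⟩ | ⟨rfl, rfl⟩
      · rwa [norm_sub_rev]
      · exact hz
    rw [frozenField, frozenField, ← Finset.add_sum_erase _ _ (Finset.mem_univ m),
      ← Finset.add_sum_erase _ (fun l => if pattern z false k l then pairForce a (z l - z k) else 0)
        (Finset.mem_univ m)]
    have h1 : pattern z true k m := .inr ⟨rfl, hzk⟩
    have h2 : ¬ pattern z false k m := by simp [pattern, hzk]
    rw [if_pos h1, if_neg h2, zero_add, add_comm]
    congr 1
    · refine Finset.sum_congr rfl fun l hl => ?_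
      rcases eq_or_ne k l with rfl | hkl
      · simp [pairForce]
      have h3 : ‖z l - z k‖ ≠ 1 := by
        have hlm := Finset.ne_of_mem_erase hl
        have h4 := h k l hkl (by
          rintro (⟨rfl, rfl⟩ | ⟨rfl, rfl⟩) <;> rcases hkm with ⟨h5, h6⟩ | ⟨h5, h6⟩ <;>
            simp_all)
        rcases h4 with h4 | h4
        · exact h4.1.ne
        · exact h4.1.ne'
      simp [pattern, h3]
    · rw [pairForce, hzk, min_self]
  rw [flux, flux, key i j (.inl ⟨rfl, rfl⟩), key j i (.inr ⟨rfl, rfl⟩)]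
  have h1 : frozenField a (pattern z false) z i + a 1 • (z j - z i)
      - (frozenField a (pattern z false) z j + a 1 • (z i - z j))
      = (frozenField a (pattern z false) z i - frozenField a (pattern z false) z j)
        - (2 * a 1) • (z i - z j) := by module
  rw [h1, inner_sub_right, real_inner_smul_right, real_inner_self_eq_norm_sq, hz]
  linarith [ha_nonneg 1 zero_le_one]

lemma abs_flux_sub_le (ha_lip : LipschitzOnWith K a (Set.Ici 0))
    (ha_nonneg : ∀ r : ℝ, 0 ≤ r → 0 ≤ a r) (ha_mono : MonotoneOn a (Set.Ici 0))
    {M : ℝ} (hM : ‖x i - x j‖ ≤ M) (z : St n N) (c : Bool) :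
    |flux a (pattern z c) i j x - flux a (pattern z c) i j z|
      ≤ (2 * M * (2 * N * (a 1 + K)) + 4 * (N * a 1)) * ‖x - z‖ := by
  set g := frozenField (n := n) a (pattern z c) with hg
  have h0 : 0 ≤ a 1 + K := add_nonneg (ha_nonneg 1 zero_le_one) K.2
  have hM0 : 0 ≤ M := (norm_nonneg _).trans hM
  have hL := (frozenField_lipschitz ha_lip ha_nonneg ha_mono (pattern z c)).dist_le_mul x z
  rw [Real.coe_toNNReal _ (by positivity), dist_eq_norm, dist_eq_norm] at hL
  have hb := norm_frozenField_pattern_le ha_nonneg ha_mono z c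
  have hd : ∀ w : St n N, ‖w i - w j‖ ≤ 2 * ‖w‖ := fun w => (norm_sub_le _ _).trans (by
    linarith [norm_le_pi_norm w i, norm_le_pi_norm w j])
  have e : flux a (pattern z c) i j x - flux a (pattern z c) i j z
      = inner ℝ (x i - x j) ((g x - g z) i - (g x - g z) j)
        + inner ℝ ((x - z) i - (x - z) j) (g z i - g z j) := by
    simp only [flux, ← hg, Pi.sub_apply, inner_sub_left, inner_sub_right]; ring
  rw [e]
  calc _ ≤ ‖x i - x j‖ * ‖(g x - g z) i - (g x - g z) j‖
        + ‖(x - z) i - (x - z) j‖ * ‖g z i - g z j‖ :=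
        (abs_add_le _ _).trans (add_le_add (abs_real_inner_le_norm _ _)
          (abs_real_inner_le_norm _ _))
    _ ≤ M * (2 * (2 * N * (a 1 + K) * ‖x - z‖)) + (2 * ‖x - z‖) * (2 * (N * a 1)) := by
        gcongr
        · exact (hd _).trans (by gcongr)
        · exact hd _
        · exact (hd _).trans (by gcongr)
    _ = _ := by ring

end Frozen

/-! ### Branching points -/

section Branching

variable {n N : ℕ} {a : ℝ → ℝ} {K : NNReal} {F : ℝ} {x y : ℝ → St n N} {s t : ℝ} {i j : Fin N}

lemma IsBoundedSol.continuousWithinAt {g : St n N → St n N} (hst : s ≤ t)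
    (hx : IsBoundedSol g F x s t) : ContinuousWithinAt x (Ici s ∩ Iic t) s := by
  have h1 : LipschitzOnWith F.toNNReal x (Icc s t) := LipschitzOnWith.of_dist_le_mul
    fun p hp q hq => by
      rw [dist_eq_norm, Real.dist_eq]
      exact (hx.speed p hp q hq).trans (by gcongr; exact Real.le_coe_toNNReal F)
  exact h1.continuousOn s (left_mem_Icc.2 hst)

lemma IsBoundedSol.exists_forall_mem {g : St n N → St n N} (hst : s < t)
    (hx : IsBoundedSol g F x s t) {U : Set (St n N)} (hU : U ∈ nhds (x s)) :
    ∃ u, s < u ∧ u ≤ t ∧ ∀ r ∈ Icc s u, x r ∈ U := by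
  have h1 := hx.continuousWithinAt hst.le hU
  rw [mem_map, Ici_inter_Iic, mem_nhdsWithin_iff_exists_mem_nhds_inter] at h1
  obtain ⟨V, hV, hVU⟩ := h1
  obtain ⟨ε, hε, hb⟩ := Metric.mem_nhds_iff.1 hV
  refine ⟨min t (s + ε / 2), lt_min hst (by linarith), min_le_left _ _, fun r hr => hVU ⟨hb ?_, ?_⟩⟩
  · rw [Metric.mem_ball, Real.dist_eq, abs_of_nonneg (by linarith [hr.1])]
    linarith [hr.2.trans (min_le_right _ _)]
  · exact ⟨hr.1, hr.2.trans (min_le_left _ _)⟩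

lemma IsBoundedSol.norm_pair_sub_le {g : St n N → St n N} (hx : IsBoundedSol g F x s t)
    {p q : ℝ} (hp : p ∈ Icc s t) (hq : q ∈ Icc s t) (i j : Fin N) :
    ‖x p i - x p j - (x q i - x q j)‖ ≤ 2 * F * |p - q| := by
  have h := hx.speed p hp q hq
  have h3 : x p i - x p j - (x q i - x q j) = (x p - x q) i - (x p - x q) j := by
    simp only [Pi.sub_apply]; abel
  rw [h3]
  refine (norm_sub_le _ _).trans ?_
  linarith [norm_le_pi_norm (x p - x q) i, norm_le_pi_norm (x p - x q) j]

lemma absolutelyContinuousOnInterval_pairDist_sq {g : St n N → St n N} (hst : s ≤ t)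
    (hx : IsBoundedSol g F x s t) (i j : Fin N) :
    AbsolutelyContinuousOnInterval (fun r => ‖x r i - x r j‖ ^ 2) s t := by
  refine absolutelyContinuousOnInterval_norm_sq (C := 2 * F) fun p hp q hq => ?_
  rw [uIcc_of_le hst] at hp hq
  exact hx.norm_pair_sub_le hp hq i j

lemma hasDerivAt_pairDist_sq {v : St n N} {r : ℝ} (hx : HasDerivAt x v r) (i j : Fin N) :
    HasDerivAt (fun r => ‖x r i - x r j‖ ^ 2) (2 * inner ℝ (x r i - x r j) (v i - v j)) r :=
  ((hasDerivAt_pi.1 hx i).sub (hasDerivAt_pi.1 hx j)).norm_sq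

/-- If no pair is at distance one, then solutions do not branch. -/
lemma not_branching_of_norm_ne_one (ha_lip : LipschitzOnWith K a (Set.Ici 0))
    (ha_nonneg : ∀ r : ℝ, 0 ≤ r → 0 ≤ a r) (ha_mono : MonotoneOn a (Set.Ici 0)) (hst : s < t)
    (hx : IsBoundedSol (fm a) F x s t) (hy : IsBoundedSol (fm a) F y s t) (h0 : x s = y s)
    (hne : ∀ i j, i ≠ j → ‖x s i - x s j‖ ≠ 1) : ∃ u, s < u ∧ ∀ r ∈ Icc s u, x r = y r := by
  set P : Fin N → Fin N → Prop := fun k l => ‖x s l - x s k‖ < 1 with hP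
  have hL := frozenField_lipschitz (n := n) ha_lip ha_nonneg ha_mono P
  have h1 : ∀ᶠ w in nhds (x s), fm a w = frozenField a P w := by
    have h2 : ∀ᶠ w : St n N in nhds (x s), ∀ k l, k ≠ l → (P k l ↔ ‖w l - w k‖ < 1) := by
      refine eventually_all.2 fun k => eventually_all.2 fun l => eventually_all.2 fun hkl => ?_
      rcases lt_or_gt_of_ne (hne l k hkl.symm) with h | h
      · have : ∀ᶠ w : St n N in nhds (x s), ‖w l - w k‖ < 1 :=
          (isOpen_lt (by fun_prop) continuous_const).mem_nhds h
        filter_upwards [this] with w hw using iff_of_true h hw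
      · have : ∀ᶠ w : St n N in nhds (x s), 1 < ‖w l - w k‖ :=
          (isOpen_lt continuous_const (by fun_prop)).mem_nhds h
        filter_upwards [this] with w hw using iff_of_false h.not_gt hw.not_gt
    filter_upwards [h2] with w hw using fm_eq_frozenField hw
  have h2 := eventually_eventually_nhds.2 h1
  obtain ⟨u, hu, hut, hxu⟩ := hx.exists_forall_mem hst h2
  obtain ⟨u', hu', hut', hyu⟩ := hy.exists_forall_mem hst (h0 ▸ h2)
  refine ⟨min u u', lt_min hu hu', fun r hr => ?_⟩
  obtain ⟨hru, hru'⟩ := le_min_iff.1 hr.2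
  refine (hx.mono le_rfl (hru.trans hut)).eq_of_ae_eq_lipschitz hL hr.1
    (hy.mono le_rfl (hru.trans hut)) (fun p hp v hv => ?_) (fun p hp v hv => ?_) h0
  · exact eq_of_mem_krasovsky hL.continuous.continuousAt
      (hxu p ⟨hp.1.le, hp.2.le.trans hru⟩) hv
  · exact eq_of_mem_krasovsky hL.continuous.continuousAt
      (hyu p ⟨hp.1.le, hp.2.le.trans hru'⟩) hv

lemma eventually_flux_ge (ha_lip : LipschitzOnWith K a (Set.Ici 0))
    (ha_nonneg : ∀ r : ℝ, 0 ≤ r → 0 ≤ a r) (ha_mono : MonotoneOn a (Set.Ici 0)) {z : St n N}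
    (hz : ‖z i - z j‖ = 1) (hside : SameSide z i j z) {σ : ℝ}
    (hpos : ∀ c, 0 < σ * flux a (pattern z c) i j z) :
    ∃ η > 0, ∀ᶠ p in nhds z, SameSide z i j p ∧
      ∀ v ∈ krasovsky (fm a) p, η ≤ σ * inner ℝ (p i - p j) (v i - v j) := by
  set G : Bool → St n N × St n N → ℝ := fun c p => σ * inner ℝ (p.1 i - p.1 j)
    (frozenField a (pattern z c) p.2 i - frozenField a (pattern z c) p.2 j) with hG
  have hcont : ∀ c, Continuous (G c) := fun c => by
    have h1 := (frozenField_lipschitz (n := n) ha_lip ha_nonneg ha_mono (pattern z c)).continuous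
    have h2 : ∀ k, Continuous fun p : St n N × St n N => frozenField a (pattern z c) p.2 k :=
      fun k => (continuous_apply k).comp (h1.comp continuous_snd)
    have h3 := h2 i
    have h4 := h2 j
    fun_prop
  have hpos' : ∀ c, 0 < G c (z, z) := hpos
  obtain ⟨η, hη, hη'⟩ := exists_between (lt_min (hpos' true) (hpos' false))
  have hev : ∀ᶠ p : St n N × St n N in nhds (z, z), ∀ c, η ≤ G c p := by
    refine eventually_all.2 fun c => ?_
    have hc : η < G c (z, z) := by
      cases c
      · exact hη'.trans_le (min_le_right _ _)
      · exact hη'.trans_le (min_le_left _ _)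
    filter_upwards [(hcont c).continuousAt.eventually (lt_mem_nhds hc)] with p hp using hp.le
  rw [nhds_prod_eq] at hev
  obtain ⟨V, hV, hVp⟩ := eventually_prod_self_iff'.1 hev
  have hopen := (isOpen_setOf_sameSide z i j).mem_nhds hside
  refine ⟨η, hη, ?_⟩
  filter_upwards [eventually_eventually_nhds.2 (inter_mem hV hopen)] with p hp
  have hpV := mem_of_mem_nhds hp
  refine ⟨hpV.2, fun v hv => ?_⟩
  refine krasovsky_subset (C := {v : St n N | η ≤ σ * inner ℝ (p i - p j) (v i - v j)})
    (isClosed_le continuous_const (by fun_prop)) ?_ ?_ hv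
  · refine convex_halfSpace_ge (𝕜 := ℝ) ⟨fun u w => ?_, fun b w => ?_⟩ _
    · simp only [Pi.add_apply]
      rw [← mul_add, ← inner_add_right]; congr 2; abel
    · simp only [Pi.smul_apply, smul_eq_mul]
      rw [← smul_sub, real_inner_smul_right]; ring
  · filter_upwards [hp] with w hw
    obtain ⟨c, hc⟩ := fm_eq_or (a := a) hz hw.2
    rw [hc]
    exact hVp p hpV.1 w hw.1 c

/-- If exactly one pair is at distance one and both one-sided fields point to the same side, then
solutions do not branch. -/
lemma not_branching_of_flux_pos (ha_lip : LipschitzOnWith K a (Set.Ici 0))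
    (ha_nonneg : ∀ r : ℝ, 0 ≤ r → 0 ≤ a r) (ha_mono : MonotoneOn a (Set.Ici 0)) (hst : s < t)
    (hx : IsBoundedSol (fm a) F x s t) (hy : IsBoundedSol (fm a) F y s t) (h0 : x s = y s)
    (hz : ‖x s i - x s j‖ = 1) (hside : SameSide (x s) i j (x s)) {c₀ : Bool}
    (hpos : ∀ c, 0 < sideSign c₀ * flux a (pattern (x s) c) i j (x s)) :
    ∃ u, s < u ∧ ∀ r ∈ Icc s u, x r = y r := by
  obtain ⟨η, hη, hev⟩ := eventually_flux_ge ha_lip ha_nonneg ha_mono hz hside hpos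
  have key : ∀ w : ℝ → St n N, IsBoundedSol (fm a) F w s t → w s = x s →
      ∃ u, s < u ∧ u ≤ t ∧ ∀ r ∈ Ioo s u, ∀ v ∈ krasovsky (fm a) (w r),
        v = frozenField a (pattern (x s) c₀) (w r) := fun w hw hws => by
    obtain ⟨u, hu, hut, hwu⟩ := hw.exists_forall_mem hst (by rw [hws]; exact hev)
    refine ⟨u, hu, hut, fun r hr v hv => ?_⟩
    refine eq_frozenField_of_mem_krasovsky ha_lip ha_nonneg ha_mono hz
      (hwu r ⟨hr.1.le, hr.2.le⟩).1 ?_ hv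
    have hw' := hw.mono le_rfl (hr.2.le.trans hut)
    have hlin : AbsolutelyContinuousOnInterval (fun p : ℝ => 2 * η * p) s r :=
      ContDiffOn.absolutelyContinuousOnInterval (ContDiff.contDiffOn (by fun_prop))
    have h1 := (((absolutelyContinuousOnInterval_pairDist_sq hr.1.le hw' i j).const_mul
      (sideSign c₀)).sub hlin).le_of_ae_deriv_nonneg hr.1.le (by
        filter_upwards [hw'.ae_deriv] with p hp hpm d hd
        obtain ⟨v, hv, hv'⟩ := hp hpm
        have h2 := ((hasDerivAt_pairDist_sq hv' i j).const_mul (sideSign c₀)).sub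
          ((hasDerivAt_id p).const_mul (2 * η))
        rw [hd.unique h2]
        have h3 := (hwu p ⟨hpm.1.le, hpm.2.le.trans hr.2.le⟩).2 v hv
        linarith)
    simp only [Pi.sub_apply, hws, hz] at h1
    nlinarith [hr.1]
  obtain ⟨u, hu, hut, hxu⟩ := key x hx rfl
  obtain ⟨u', hu', hut', hyu⟩ := key y hy h0.symm
  refine ⟨min u u', lt_min hu hu', fun r hr => ?_⟩
  obtain ⟨hru, hru'⟩ := le_min_iff.1 hr.2
  exact (hx.mono le_rfl (hru.trans hut)).eq_of_ae_eq_lipschitz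
    (frozenField_lipschitz ha_lip ha_nonneg ha_mono _) hr.1 (hy.mono le_rfl (hru.trans hut))
    (fun p hp => hxu p ⟨hp.1, hp.2.trans_le hru⟩) (fun p hp => hyu p ⟨hp.1, hp.2.trans_le hru'⟩) h0

/-- At a branching point at which exactly one pair is at distance one, both one-sided fields point
away from the discontinuity. -/
lemma flux_nonneg_of_branching (ha_lip : LipschitzOnWith K a (Set.Ici 0))
    (ha_nonneg : ∀ r : ℝ, 0 ≤ r → 0 ≤ a r) (ha_mono : MonotoneOn a (Set.Ici 0)) (hst : s < t)
    (hx : IsBoundedSol (fm a) F x s t) (hy : IsBoundedSol (fm a) F y s t) (h0 : x s = y s)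
    (hij : i ≠ j) (hz : ‖x s i - x s j‖ = 1) (hside : SameSide (x s) i j (x s))
    (hbr : ¬ ∃ u, s < u ∧ ∀ r ∈ Icc s u, x r = y r) (c : Bool) :
    0 ≤ sideSign c * flux a (pattern (x s) c) i j (x s) := by
  by_contra! hneg
  refine hbr (not_branching_of_flux_pos (c₀ := !c) ha_lip ha_nonneg ha_mono hst hx hy h0 hz hside
    fun b => ?_)
  have h1 := flux_pattern_true_le ha_nonneg hij hz hside
  cases b <;> cases c <;> simp only [sideSign] at * <;> norm_num at * <;> linarith

/-- Quadratic approach to the discontinuity before a point where both one-sided fields point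
away from it. -/
lemma abs_pairDist_sq_sub_one_le (ha_lip : LipschitzOnWith K a (Set.Ici 0))
    (ha_nonneg : ∀ r : ℝ, 0 ≤ r → 0 ≤ a r) (ha_mono : MonotoneOn a (Set.Ici 0)) (hst : s ≤ t)
    (hF : 0 ≤ F) (hst1 : t - s ≤ 1)
    (hx : IsBoundedSol (fm a) F x s t) (hz : ‖x t i - x t j‖ = 1)
    (hside : ∀ r ∈ Icc s t, SameSide (x t) i j (x r))
    (hflux : ∀ c, 0 ≤ sideSign c * flux a (pattern (x t) c) i j (x t)) :
    |‖x s i - x s j‖ ^ 2 - 1|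
      ≤ 2 * (2 * (1 + 2 * F) * (2 * N * (a 1 + K)) + 4 * (N * a 1)) * F * (t - s) ^ 2 := by
  set C := 2 * (1 + 2 * F) * (2 * N * (a 1 + K)) + 4 * (N * a 1) with hC
  have ha1 := ha_nonneg 1 zero_le_one
  have hK : (0:ℝ) ≤ K := K.2
  have hC0 : 0 ≤ C := by positivity
  have hpair : ∀ p ∈ Icc s t, ∀ q ∈ Icc s t, ‖(x p i - x p j) - (x q i - x q j)‖
      ≤ 2 * F * |p - q| := fun p hp q hq => hx.norm_pair_sub_le hp hq i j
  have htm : t ∈ Icc s t := right_mem_Icc.2 hst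
  have habs : ∀ p ∈ Icc s t, |p - t| ≤ t - s := fun p hp => by
    rw [abs_sub_comm, abs_of_nonneg (by linarith [hp.2])]; linarith [hp.1]
  have hM : ∀ p ∈ Icc s t, ‖x p i - x p j‖ ≤ 1 + 2 * F := fun p hp => by
    have h1 := norm_le_norm_add_norm_sub' (x p i - x p j) (x t i - x t j)
    have h2 := hpair p hp t htm
    have h3 : 2 * F * |p - t| ≤ 2 * F * 1 := by gcongr; exact (habs p hp).trans hst1
    rw [hz] at h1
    linarith
  obtain ⟨c, hc⟩ := exists_sideSign_mul_eq_abs (‖x s i - x s j‖ ^ 2 - 1)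
  set m : ℝ → ℝ := fun r => max (sideSign c * (‖x r i - x r j‖ ^ 2 - 1)) 0 with hm
  have hmlip : LipschitzOnWith (2 * (1 + 2 * F) * (2 * F)).toNNReal m (uIcc s t) := by
    refine LipschitzOnWith.of_dist_le_mul fun p hp q hq => ?_
    rw [uIcc_of_le hst] at hp hq
    rw [Real.coe_toNNReal _ (by positivity), Real.dist_eq, Real.dist_eq]
    refine (abs_max_sub_max_le_abs _ _ _).trans ?_
    rw [← mul_sub, abs_sideSign_mul, sub_sub_sub_cancel_right, sq_sub_sq, abs_mul,
      abs_of_nonneg (by positivity : 0 ≤ ‖x p i - x p j‖ + ‖x q i - x q j‖)]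
    calc _ ≤ (2 * (1 + 2 * F)) * (2 * F * |p - q|) := by
          gcongr
          · linarith [hM p hp, hM q hq]
          · exact (abs_norm_sub_norm_le _ _).trans (hpair p hp q hq)
      _ = _ := by ring
  have hlin : AbsolutelyContinuousOnInterval (fun r : ℝ => 2 * (C * (F * (t - s))) * r) s t :=
    ContDiffOn.absolutelyContinuousOnInterval (ContDiff.contDiffOn (by fun_prop))
  have h1 := (hmlip.absolutelyContinuousOnInterval.add hlin).le_of_ae_deriv_nonneg hst (by
    filter_upwards [hx.ae_deriv] with r hr hrm d hd
    obtain ⟨v, hv, hv'⟩ := hr hrm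
    have hrI : r ∈ Icc s t := Ioo_subset_Icc_self hrm
    have hd' : HasDerivAt m (d - 2 * (C * (F * (t - s)))) r := by
      have h2 := hd.sub ((hasDerivAt_id' r).const_mul (2 * (C * (F * (t - s)))))
      rw [mul_one] at h2
      exact h2.congr_of_eventuallyEq (.of_forall fun q => by simp)
    have hnn : 0 ≤ 2 * (C * (F * (t - s))) := by
      have : 0 ≤ t - s := by linarith
      positivity
    rcases le_or_gt (sideSign c * (‖x r i - x r j‖ ^ 2 - 1)) 0 with h4 | h4
    · have h5 : IsLocalMin m r := .of_forall fun q => by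
        simp only [hm, max_eq_right h4]; exact le_max_right _ _
      have h6 := h5.hasDerivAt_eq_zero hd'
      linarith
    · have h5 := hasDerivAt_pairDist_sq hv' i j
      have h6 : m =ᶠ[nhds r] fun r => sideSign c * (‖x r i - x r j‖ ^ 2 - 1) := by
        have h7 := ((h5.sub_const 1).const_mul (sideSign c)).continuousAt.eventually
          (lt_mem_nhds h4)
        filter_upwards [h7] with q hq using max_eq_left hq.le
      have h8 := hd'.unique (((h5.sub_const 1).const_mul (sideSign c)).congr_of_eventuallyEq h6)
      rw [eq_frozenField_of_mem_krasovsky ha_lip ha_nonneg ha_mono hz (hside r hrI) h4 hv] at h8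
      have h9 := abs_flux_sub_le ha_lip ha_nonneg ha_mono (hM r hrI) (x t) c
      rw [← abs_sideSign_mul c, ← hC] at h9
      have h10 : C * ‖x r - x t‖ ≤ C * (F * (t - s)) := by
        gcongr
        exact (hx.speed r hrI t htm).trans (by gcongr; exact habs r hrI)
      have h11 := (abs_le.1 h9).1
      have h12 := hflux c
      rw [mul_sub] at h11
      have h13 : d - 2 * (C * (F * (t - s)))
        = 2 * (sideSign c * flux a (pattern (x t) c) i j (x r)) := by rw [h8, flux]; ring
      linarith)
  simp only [Pi.add_apply] at h1
  have h2 : m t = 0 := by simp [hm, hz]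
  have h3 : |‖x s i - x s j‖ ^ 2 - 1| ≤ m s := hc ▸ le_max_left _ _
  rw [h2] at h1
  linarith

end Branching

/-! ### Dichotomy before a branching point -/

section Dichotomy

variable {n N : ℕ} {a : ℝ → ℝ} {K : NNReal} {F : ℝ} {x y : ℝ → St n N} {s t T : ℝ}

lemma exists_branching_point {g : St n N → St n N} (hF : 0 < F)
    (hx : IsBoundedSol g F x 0 T) (hy : IsBoundedSol g F y 0 T) (h0 : x 0 = y 0)
    (ht : t ∈ Icc 0 T) (hne : x t ≠ y t) :
    ∃ s ∈ Ico 0 T, x s = y s ∧ ¬ ∃ u, s < u ∧ ∀ r ∈ Icc s u, x r = y r := by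
  set B : Set ℝ := {r | r ∈ Icc 0 T ∧ x r ≠ y r} with hB
  have hBne : B.Nonempty := ⟨t, ht, hne⟩
  have hBb : BddBelow B := ⟨0, fun r hr => hr.1.1⟩
  have hs0 : 0 ≤ sInf B := le_csInf hBne fun r hr => hr.1.1
  have hst : sInf B ≤ t := csInf_le hBb ⟨ht, hne⟩
  have hlt : ∀ r, 0 ≤ r → r < sInf B → x r = y r := fun r hr hrs => by
    by_contra h
    exact notMem_of_lt_csInf hrs hBb ⟨⟨hr, (hrs.le.trans hst).trans ht.2⟩, h⟩
  have hsT : sInf B ∈ Icc 0 T := ⟨hs0, hst.trans ht.2⟩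
  have heq : x (sInf B) = y (sInf B) := by
    rcases hs0.eq_or_lt with h | h
    · rw [← h, h0]
    by_contra hne'
    have hd : 0 < ‖x (sInf B) - y (sInf B)‖ := norm_pos_iff.2 (sub_ne_zero.2 hne')
    set d := ‖x (sInf B) - y (sInf B)‖ with hdd
    set r := max 0 (sInf B - d / (4 * F)) with hr
    have hrs : r < sInf B := max_lt h (by linarith [div_pos hd (by positivity : 0 < 4 * F)])
    have hrT : r ∈ Icc 0 T := ⟨le_max_left _ _, hrs.le.trans hsT.2⟩
    have h1 := hx.speed _ hsT r hrT
    have h2 := hy.speed _ hsT r hrT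
    rw [abs_of_pos (by linarith)] at h1 h2
    have h3 : d ≤ ‖x (sInf B) - x r‖ + ‖y (sInf B) - y r‖ := by
      rw [hdd, ← sub_sub_sub_cancel_right _ _ (x r), hlt r hrT.1 hrs]
      exact norm_sub_le _ _
    have h4 : F * (sInf B - r) ≤ F * (d / (4 * F)) := by
      gcongr; linarith [le_max_right 0 (sInf B - d / (4 * F))]
    have h5 : F * (d / (4 * F)) = d / 4 := by field_simp
    linarith
  refine ⟨sInf B, ⟨hs0, lt_of_le_of_ne hsT.2 fun h => ?_⟩, heq, ?_⟩
  · have : t = sInf B := le_antisymm (h ▸ ht.2) hst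
    exact hne (this ▸ heq)
  · rintro ⟨u, hu, hxy⟩
    obtain ⟨r, hr, hru⟩ := exists_lt_of_csInf_lt hBne hu
    exact hr.2 (hxy r ⟨csInf_le hBb hr, hru.le⟩)

/-- States at which one pair is quadratically close to the discontinuity, or two different pairs
are linearly close to it. -/
def nearDiscontinuity (n N : ℕ) (C τ : ℝ) : Set (St n N) :=
  {x | (∃ i j, i ≠ j ∧ |‖x i - x j‖ ^ 2 - 1| ≤ C * τ ^ 2) ∨
    ∃ i j k l, i ≠ j ∧ l ≠ k ∧ l ≠ i ∧ l ≠ j ∧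
      |‖x i - x j‖ - 1| ≤ C * τ ∧ |‖x l - x k‖ - 1| ≤ C * τ}

/-- Shortly before a branching point, the solution is close to the discontinuity. -/
lemma mem_nearDiscontinuity_of_branching (ha_lip : LipschitzOnWith K a (Set.Ici 0))
    (ha_nonneg : ∀ r : ℝ, 0 ≤ r → 0 ≤ a r) (ha_mono : MonotoneOn a (Set.Ici 0)) (hF : 0 < F)
    {C τ p : ℝ} (hC : 4 * F ≤ C)
    (hC' : 2 * (2 * (1 + 2 * F) * (2 * N * (a 1 + K)) + 4 * (N * a 1)) * F ≤ C)
    (hx : IsBoundedSol (fm a) F x 0 T) (hy : IsBoundedSol (fm a) F y 0 T) (hs : s ∈ Ico 0 T)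
    (h0 : x s = y s) (hbr : ¬ ∃ u, s < u ∧ ∀ r ∈ Icc s u, x r = y r)
    (hp : p ∈ Icc 0 s) (hτ : s - p ≤ τ) (hτ1 : τ ≤ 1) : x p ∈ nearDiscontinuity n N C τ := by
  have hxs := hx.mono hs.1 le_rfl
  have hys := hy.mono hs.1 le_rfl
  have hxp := hx.mono hp.1 hs.2.le
  have hsm : s ∈ Icc p s := right_mem_Icc.2 hp.2
  have hpm : p ∈ Icc p s := left_mem_Icc.2 hp.2
  have hτ0 : 0 ≤ τ := by linarith [hp.2]
  have hpair : ∀ r ∈ Icc p s, ∀ k l, |‖x r k - x r l‖ - ‖x s k - x s l‖| ≤ 2 * F * τ :=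
    fun r hr k l => (abs_norm_sub_norm_le _ _).trans <|
    (hxp.norm_pair_sub_le hr hsm k l).trans (by
      have : |r - s| ≤ τ := by
        rw [abs_sub_comm, abs_of_nonneg (by linarith [hr.2])]; linarith [hr.1]
      gcongr)
  have hFτ : 0 ≤ F * τ := by positivity
  have hCτ : 4 * F * τ ≤ C * τ := by gcongr
  obtain ⟨i, j, hij, hz⟩ : ∃ i j, i ≠ j ∧ ‖x s i - x s j‖ = 1 := by
    by_contra! h
    exact hbr (not_branching_of_norm_ne_one ha_lip ha_nonneg ha_mono hs.2 hxs hys h0 h)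
  by_cases hother : ∃ k l, k ≠ l ∧ ¬ ((k = i ∧ l = j) ∨ (k = j ∧ l = i)) ∧
      |‖x s l - x s k‖ - 1| ≤ 2 * F * τ
  · right
    obtain ⟨k, l, hkl, hne, hle⟩ := hother
    have key : ∀ k l, |‖x s l - x s k‖ - 1| ≤ 2 * F * τ → |‖x p l - x p k‖ - 1| ≤ C * τ :=
      fun k l h => by
        have h1 := abs_sub_le ‖x p l - x p k‖ ‖x s l - x s k‖ 1
        linarith [hpair p hpm l k]
    have hijp : |‖x p i - x p j‖ - 1| ≤ C * τ := key j i (by rw [hz]; simp; linarith)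
    by_cases hl : l = i ∨ l = j
    · refine ⟨i, j, l, k, hij, hkl, ?_, ?_, hijp, key l k (by rwa [norm_sub_rev])⟩
      · grind
      · grind
    · push Not at hl
      exact ⟨i, j, k, l, hij, hkl.symm, hl.1, hl.2, hijp, key k l hle⟩
  · left
    push Not at hother
    have hside : ∀ r ∈ Icc p s, SameSide (x s) i j (x r) := fun r hr k l hkl hne => by
      have h1 := hother k l hkl (by tauto)
      have h2 := abs_le.1 (hpair r hr l k)
      rcases lt_abs.1 h1 with h | h
      · right; constructor <;> linarith
      · left; constructor <;> linarith
    have hflux := flux_nonneg_of_branching ha_lip ha_nonneg ha_mono hs.2 hxs hys h0 hij hz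
      (hside s hsm) hbr
    refine ⟨i, j, hij, (abs_pairDist_sq_sub_one_le ha_lip ha_nonneg ha_mono hp.2 hF.le
      (hτ.trans hτ1) hxp hz hside hflux).trans ?_⟩
    have h1 : 0 ≤ s - p := by linarith [hp.2]
    have h2 : 0 ≤ C := by linarith
    gcongr

end Dichotomy

/-! ### Volume estimates -/

section Volume

lemma measure_le_of_expandingOn {E : Type*} [NormedAddCommGroup E] [NormedSpace ℝ E]
    [FiniteDimensional ℝ E] [MeasurableSpace E] [BorelSpace E] (μ : Measure E)
    [μ.IsAddHaarMeasure] {C : NNReal} {S : Set E} {e : E → E}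
    (h : ∀ x ∈ S, ∀ y ∈ S, dist x y ≤ C * dist (e x) (e y)) :
    μ S ≤ (C : ENNReal) ^ (Module.finrank ℝ E) * μ (e '' S) := by
  have hinj : InjOn e S := fun x hx y hy hxy => by
    have h1 := h x hx y hy
    rw [hxy, dist_self, mul_zero] at h1
    exact dist_le_zero.1 h1
  have hc := Measure.isAddLeftInvariant_eq_smul μ
    (Measure.hausdorffMeasure (X := E) (Module.finrank ℝ E))
  have hlip : LipschitzOnWith C (Function.invFunOn e S) (e '' S) := by
    refine LipschitzOnWith.of_dist_le_mul ?_
    rintro _ ⟨x, hx, rfl⟩ _ ⟨y, hy, rfl⟩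
    rw [hinj.leftInvOn_invFunOn hx, hinj.leftInvOn_invFunOn hy]
    exact h x hx y hy
  have h1 := hlip.hausdorffMeasure_image_le (d := Module.finrank ℝ E) (Nat.cast_nonneg _)
  rw [hinj.leftInvOn_invFunOn.image_image, ENNReal.rpow_natCast] at h1
  rw [hc, Measure.smul_apply, Measure.smul_apply, ENNReal.smul_def, ENNReal.smul_def, smul_eq_mul,
    smul_eq_mul, mul_left_comm]
  gcongr

lemma exists_volume_annulus_le {n : ℕ} (hn : 1 ≤ n) : ∃ c : ENNReal, c ≠ ⊤ ∧
    ∀ η : ℝ, 0 ≤ η → η ≤ 1 →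
      volume {u : EuclideanSpace ℝ (Fin n) | |‖u‖ - 1| ≤ η} ≤ c * ENNReal.ofReal η := by
  have : Nonempty (Fin n) := ⟨⟨0, hn⟩⟩
  set V := volume (Metric.ball (0 : EuclideanSpace ℝ (Fin n)) 1) with hV
  have hVtop : V ≠ ⊤ := measure_ball_lt_top.ne
  refine ⟨ENNReal.ofReal (2 * n * 2 ^ (n - 1)) * V, by finiteness, fun η h0 h1 => ?_⟩
  have hsub : {u : EuclideanSpace ℝ (Fin n) | |‖u‖ - 1| ≤ η}
      ⊆ Metric.closedBall 0 (1 + η) \ Metric.ball 0 (1 - η) := fun u hu => by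
    have : -η ≤ ‖u‖ - 1 ∧ ‖u‖ - 1 ≤ η := abs_le.1 hu
    simp only [Set.mem_sdiff, mem_closedBall_zero_iff, mem_ball_zero_iff, not_lt]
    constructor <;> linarith
  have hsub' : Metric.ball (0 : EuclideanSpace ℝ (Fin n)) (1 - η) ⊆ Metric.closedBall 0 (1 + η) :=
    Metric.ball_subset_closedBall.trans (Metric.closedBall_subset_closedBall (by linarith))
  have hpow : (1 + η) ^ n - (1 - η) ^ n ≤ 2 * n * 2 ^ (n - 1) * η := by
    have h2 := (le_abs_self _).trans (abs_pow_sub_pow_le (1 + η) (1 - η) n)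
    have h3 : max |1 + η| |1 - η| ≤ 2 := by
      rw [abs_of_nonneg (by linarith), abs_of_nonneg (by linarith)]
      exact max_le (by linarith) (by linarith)
    have h4 : |1 + η - (1 - η)| = 2 * η := by
      rw [abs_of_nonneg (by linarith)]; ring
    rw [h4] at h2
    calc _ ≤ _ := h2
      _ ≤ 2 * η * n * 2 ^ (n - 1) := by gcongr
      _ = _ := by ring
  refine (measure_mono hsub).trans ?_
  rw [measure_sdiff hsub' Metric.isOpen_ball.measurableSet.nullMeasurableSet
    measure_ball_lt_top.ne, Measure.addHaar_closedBall _ _ (by linarith : 0 ≤ 1 + η),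
    Measure.addHaar_ball _ _ (by linarith : 0 ≤ 1 - η), ← ENNReal.sub_mul (fun _ _ => hVtop),
    ← ENNReal.ofReal_sub _ (by positivity), mul_right_comm,
    ← ENNReal.ofReal_mul (by positivity), finrank_euclideanSpace_fin]
  gcongr

lemma exists_volume_shear_le (n N : ℕ) (R : ℝ) : ∃ c : ENNReal, c ≠ ⊤ ∧
    ∀ (s : Finset (Fin N)) (pa : Fin N → Fin N) (A : Set (EuclideanSpace ℝ (Fin n))),
      (∀ u : St n N, ‖u‖ ≤ 3 * ‖(fun m => if m ∈ s then u m - u (pa m) else u m : St n N)‖) →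
      volume {x : St n N | x ∈ Metric.closedBall 0 R ∧ ∀ m ∈ s, x m - x (pa m) ∈ A}
        ≤ c * volume A ^ s.card := by
  set V := volume (Metric.closedBall (0 : EuclideanSpace ℝ (Fin n)) R) with hV
  have hVtop : V ≠ ⊤ := measure_closedBall_lt_top.ne
  refine ⟨((3 : NNReal) : ENNReal) ^ (Module.finrank ℝ (St n N)) * (max 1 V) ^ N,
    by finiteness, fun s pa A hA => ?_⟩
  set e : St n N → St n N := fun u m => if m ∈ s then u m - u (pa m) else u m with he
  have he_sub : ∀ u v, e u - e v = e (u - v) := fun u v => by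
    ext1 m
    simp only [he, Pi.sub_apply]
    split_ifs <;> abel
  refine (measure_le_of_expandingOn volume (C := 3) (e := e) fun x _ y _ => ?_).trans ?_
  · rw [dist_eq_norm, dist_eq_norm, he_sub]
    exact hA (x - y)
  rw [mul_assoc]
  gcongr
  have hsub : e '' {x : St n N | x ∈ Metric.closedBall 0 R ∧ ∀ m ∈ s, x m - x (pa m) ∈ A}
      ⊆ univ.pi fun m => if m ∈ s then A else Metric.closedBall 0 R := by
    rintro _ ⟨x, ⟨hx, hxA⟩, rfl⟩ m -
    rw [mem_closedBall_zero_iff] at hx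
    by_cases hm : m ∈ s
    · simpa [he, hm] using hxA m hm
    · simpa [he, hm] using (norm_le_pi_norm x m).trans hx
  refine (measure_mono hsub).trans ?_
  rw [volume_pi_pi]
  have h1 : ∀ m, volume (if m ∈ s then A else Metric.closedBall 0 R)
      = if m ∈ s then volume A else V := fun m => by split_ifs <;> rfl
  simp only [h1]
  rw [Finset.prod_ite, Finset.prod_const, Finset.prod_const, mul_comm, Finset.filter_mem_eq_inter,
    Finset.univ_inter]
  gcongr
  · exact le_max_left _ _
  · exact le_max_right _ _
  · exact (Finset.card_le_univ _).trans_eq (by simp)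

lemma abs_sub_one_le_of_abs_sq_sub_one_le {r η : ℝ} (hr : 0 ≤ r) (h : |r ^ 2 - 1| ≤ η) :
    |r - 1| ≤ η := by
  refine le_trans ?_ h
  have h1 : r ^ 2 - 1 = (r - 1) * (r + 1) := by ring
  rw [h1, abs_mul, abs_of_nonneg (by linarith : 0 ≤ r + 1)]
  nlinarith [abs_nonneg (r - 1)]

lemma exists_volume_pair_le {n : ℕ} (N : ℕ) (hn : 1 ≤ n) (R : ℝ) : ∃ c : ENNReal, c ≠ ⊤ ∧
    ∀ η : ℝ, 0 ≤ η → η ≤ 1 → ∀ i j : Fin N, i ≠ j →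
      volume {x : St n N | x ∈ Metric.closedBall 0 R ∧ |‖x i - x j‖ - 1| ≤ η}
        ≤ c * ENNReal.ofReal η := by
  obtain ⟨c₁, hc₁, h₁⟩ := exists_volume_annulus_le hn
  obtain ⟨c₂, hc₂, h₂⟩ := exists_volume_shear_le n N R
  refine ⟨c₂ * c₁, by finiteness, fun η h0 h1 i j hij => ?_⟩
  have h3 := h₂ {i} (fun _ => j) {u | |‖u‖ - 1| ≤ η} fun u => by
    set w : St n N := fun m => if m ∈ ({i} : Finset (Fin N)) then u m - u j else u m with hw
    have hwm : ∀ m, m ≠ i → ‖u m‖ ≤ ‖w‖ := fun m hm => by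
      have := norm_le_pi_norm w m
      simpa [hw, hm] using this
    have hwi : ‖u i - u j‖ ≤ ‖w‖ := by
      have := norm_le_pi_norm w i
      simpa [hw] using this
    have hui := norm_le_norm_add_norm_sub' (u i) (u j)
    have huj := hwm j hij.symm
    refine (pi_norm_le_iff_of_nonneg (by positivity)).2 fun m => ?_
    rcases eq_or_ne m i with rfl | hm
    · linarith [norm_nonneg w]
    · linarith [hwm m hm, norm_nonneg w]
  simp only [Finset.mem_singleton, forall_eq, Finset.card_singleton, pow_one, mem_ofPred_eq] at h3
  refine h3.trans ?_
  rw [mul_assoc]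
  gcongr
  exact h₁ η h0 h1

lemma exists_volume_two_pairs_le {n : ℕ} (N : ℕ) (hn : 1 ≤ n) (R : ℝ) : ∃ c : ENNReal, c ≠ ⊤ ∧
    ∀ η : ℝ, 0 ≤ η → η ≤ 1 → ∀ i j k l : Fin N, i ≠ j → l ≠ k → l ≠ i → l ≠ j →
      volume {x : St n N | x ∈ Metric.closedBall 0 R ∧
          |‖x i - x j‖ - 1| ≤ η ∧ |‖x l - x k‖ - 1| ≤ η}
        ≤ c * ENNReal.ofReal η ^ 2 := by
  obtain ⟨c₁, hc₁, h₁⟩ := exists_volume_annulus_le hn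
  obtain ⟨c₂, hc₂, h₂⟩ := exists_volume_shear_le n N R
  refine ⟨c₂ * c₁ ^ 2, by finiteness, fun η h0 h1 i j k l hij hlk hli hlj => ?_⟩
  set pa : Fin N → Fin N := fun m => if m = i then j else k with hpa
  have hpai : pa i = j := by simp [hpa]
  have hpal : pa l = k := by simp [hpa, hli]
  have h3 := h₂ {i, l} pa {u | |‖u‖ - 1| ≤ η} fun u => by
    set w : St n N := fun m => if m ∈ ({i, l} : Finset (Fin N)) then u m - u (pa m) else u m
      with hw
    have hwm : ∀ m, m ≠ i → m ≠ l → ‖u m‖ ≤ ‖w‖ := fun m hm hm' => by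
      have := norm_le_pi_norm w m
      simpa [hw, hm, hm'] using this
    have hwi : ‖u i - u j‖ ≤ ‖w‖ := by
      have := norm_le_pi_norm w i
      simpa [hw, hpai] using this
    have hwl : ‖u l - u k‖ ≤ ‖w‖ := by
      have := norm_le_pi_norm w l
      simpa [hw, hpal] using this
    have huj := hwm j hij.symm hlj.symm
    have hui : ‖u i‖ ≤ 2 * ‖w‖ := by linarith [norm_le_norm_add_norm_sub' (u i) (u j)]
    have huk : ‖u k‖ ≤ 2 * ‖w‖ := by
      rcases eq_or_ne k i with rfl | hki
      · exact hui
      · linarith [hwm k hki hlk.symm, norm_nonneg w]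
    have hul := norm_le_norm_add_norm_sub' (u l) (u k)
    refine (pi_norm_le_iff_of_nonneg (by positivity)).2 fun m => ?_
    rcases eq_or_ne m i with rfl | hm
    · linarith [norm_nonneg w]
    rcases eq_or_ne m l with rfl | hm'
    · linarith [norm_nonneg w]
    · linarith [hwm m hm hm', norm_nonneg w]
  rw [Finset.card_pair hli.symm] at h3
  simp only [Finset.mem_insert, Finset.mem_singleton, forall_eq_or_imp, forall_eq, hpai, hpal,
    mem_ofPred_eq] at h3
  refine h3.trans ?_
  rw [mul_assoc, ← mul_pow]
  gcongr
  exact h₁ η h0 h1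

lemma exists_volume_nearDiscontinuity_le {n : ℕ} (N : ℕ) (hn : 1 ≤ n) {C : ℝ} (hC : 1 ≤ C)
    (R : ℝ) : ∃ c : ENNReal, c ≠ ⊤ ∧ ∀ τ : ℝ, 0 ≤ τ → C * τ ≤ 1 →
      volume (nearDiscontinuity n N C τ ∩ Metric.closedBall 0 R) ≤ c * ENNReal.ofReal (τ ^ 2) := by
  obtain ⟨c₁, hc₁, h₁⟩ := exists_volume_pair_le N hn R
  obtain ⟨c₂, hc₂, h₂⟩ := exists_volume_two_pairs_le N hn R
  refine ⟨N * (N * (c₁ * ENNReal.ofReal C)) +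
    N * (N * (N * (N * (c₂ * ENNReal.ofReal C ^ 2)))), by finiteness, fun τ h0 h1 => ?_⟩
  have hτ1 : τ ≤ 1 := by nlinarith
  have hsub : nearDiscontinuity n N C τ ∩ Metric.closedBall 0 R ⊆
      (⋃ i, ⋃ j, {x : St n N | i ≠ j ∧ x ∈ Metric.closedBall 0 R ∧
        |‖x i - x j‖ - 1| ≤ C * τ ^ 2}) ∪
      ⋃ i, ⋃ j, ⋃ k, ⋃ l, {x : St n N | (i ≠ j ∧ l ≠ k ∧ l ≠ i ∧ l ≠ j) ∧
        x ∈ Metric.closedBall 0 R ∧ |‖x i - x j‖ - 1| ≤ C * τ ∧ |‖x l - x k‖ - 1| ≤ C * τ} := by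
    rintro x ⟨⟨i, j, hij, h⟩ | ⟨i, j, k, l, hij, hlk, hli, hlj, h, h'⟩, hx⟩
    · left
      simp only [mem_iUnion]
      exact ⟨i, j, hij, hx, abs_sub_one_le_of_abs_sq_sub_one_le (norm_nonneg _) h⟩
    · right
      simp only [mem_iUnion]
      exact ⟨i, j, k, l, ⟨hij, hlk, hli, hlj⟩, hx, h, h'⟩
  have hU : ∀ (f : Fin N → Set (St n N)) (b : ENNReal), (∀ i, volume (f i) ≤ b) →
      volume (⋃ i, f i) ≤ N * b := fun f b hf =>
    (measure_iUnion_fintype_le _ _).trans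
      ((Finset.sum_le_card_nsmul _ _ b fun i _ => hf i).trans_eq (by simp))
  have hτ2 : ENNReal.ofReal (τ ^ 2) = ENNReal.ofReal τ ^ 2 := ENNReal.ofReal_pow h0 2
  refine (measure_mono hsub).trans ((measure_union_le _ _).trans ?_)
  rw [add_mul]
  gcongr
  · rw [mul_assoc, mul_assoc]
    refine hU _ _ fun i => hU _ _ fun j => ?_
    by_cases hij : i = j
    · simp [hij]
    · simp only [ne_eq, hij, not_false_eq_true, true_and]
      rw [mul_assoc, ← ENNReal.ofReal_mul (by positivity)]
      exact h₁ _ (by positivity) (by nlinarith) i j hij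
  · rw [mul_assoc, mul_assoc, mul_assoc, mul_assoc]
    refine hU _ _ fun i => hU _ _ fun j => hU _ _ fun k => hU _ _ fun l => ?_
    by_cases hcond : i ≠ j ∧ l ≠ k ∧ l ≠ i ∧ l ≠ j
    · simp only [hcond, not_false_eq_true, true_and, ne_eq]
      rw [mul_assoc, hτ2, ← mul_pow, ← ENNReal.ofReal_mul (by positivity)]
      exact h₂ _ (by positivity) h1 i j k l hcond.1 hcond.2.1 hcond.2.2.1 hcond.2.2.2
    · simp only [hcond, false_and, ofPred_false, measure_empty, zero_le]

end Volume

/-! ### Initial data with several solutions -/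

section Exceptional

variable {n N : ℕ} {a : ℝ → ℝ} {K : NNReal} {F : ℝ}

/-- Initial data in a ball from which a solution reaches the set `D` at time `p`. -/
def reachingSet (a : ℝ → ℝ) (F R p : ℝ) (D : Set (St n N)) : Set (St n N) :=
  {z | ‖z‖ ≤ R ∧ ∃ x : ℝ → St n N, x 0 = z ∧ IsBoundedSol (fm a) F x 0 p ∧ x p ∈ D}

lemma exists_volume_reachingSet_le (n N : ℕ) (ha_lip : LipschitzOnWith K a (Set.Ici 0))
    (ha_nonneg : ∀ r : ℝ, 0 ≤ r → 0 ≤ a r) (ha_mono : MonotoneOn a (Set.Ici 0)) (hF : 0 ≤ F)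
    (R T : ℝ) : ∃ c : ENNReal, c ≠ ⊤ ∧ ∀ p ∈ Icc 0 T, ∀ D : Set (St n N),
      volume (reachingSet a F R p D) ≤ c * volume (D ∩ Metric.closedBall 0 (R + F * T)) := by
  have ha1 := ha_nonneg 1 zero_le_one
  have hK : (0:ℝ) ≤ K := K.2
  set L := Real.sqrt (Real.exp (4 * N * (a 1 + K) * T) * N)
  refine ⟨(L.toNNReal : ENNReal) ^ (Module.finrank ℝ (St n N)), by finiteness, fun p hp D => ?_⟩
  choose! w hw using fun z (hz : z ∈ reachingSet a F R p D) => hz.2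
  refine (measure_le_of_expandingOn volume (C := L.toNNReal) (e := fun z => w z p)
    fun z hz z' hz' => ?_).trans ?_
  · obtain ⟨h0, hx, -⟩ := hw z hz
    obtain ⟨h0', hx', -⟩ := hw z' hz'
    have h1 := hx.backward_dist_sq_le ha_lip ha_nonneg ha_mono hp.1 hx'
    rw [h0, h0'] at h1
    rw [dist_eq_norm, dist_eq_norm, Real.coe_toNNReal _ (Real.sqrt_nonneg _)]
    refine le_of_sq_le_sq ?_ (by positivity)
    rw [mul_pow, Real.sq_sqrt (by positivity)]
    calc _ ≤ _ := norm_sq_le_sum (z - z')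
      _ ≤ _ := h1
      _ ≤ Real.exp (4 * N * (a 1 + K) * T) * (N * ‖w z p - w z' p‖ ^ 2) := by
        gcongr
        · linarith [hp.2]
        · exact sum_norm_sq_le (w z p - w z' p)
      _ = _ := by ring
  · gcongr
    rintro _ ⟨z, hz, rfl⟩
    obtain ⟨h0, hx, hD⟩ := hw z hz
    refine ⟨hD, ?_⟩
    rw [mem_closedBall_zero_iff]
    have h1 := hx.speed p (right_mem_Icc.2 hp.1) 0 (left_mem_Icc.2 hp.1)
    rw [h0, sub_zero, abs_of_nonneg hp.1] at h1
    have h2 := norm_le_norm_add_norm_sub' (w z p) z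
    have h3 : F * p ≤ F * T := by gcongr; exact hp.2
    linarith [hz.1]

/-- Initial data in a ball admitting two different solutions before time `T`. -/
def nonuniqueSet (n N : ℕ) (a : ℝ → ℝ) (F R T : ℝ) : Set (St n N) :=
  {z | ‖z‖ ≤ R ∧ ∃ T' ≤ T, ∃ x y : ℝ → St n N, x 0 = z ∧ y 0 = z ∧
    IsBoundedSol (fm a) F x 0 T' ∧ IsBoundedSol (fm a) F y 0 T' ∧ ∃ t ∈ Icc 0 T', x t ≠ y t}

lemma nonuniqueSet_subset (ha_lip : LipschitzOnWith K a (Set.Ici 0))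
    (ha_nonneg : ∀ r : ℝ, 0 ≤ r → 0 ≤ a r) (ha_mono : MonotoneOn a (Set.Ici 0)) (hF : 0 < F)
    {C R : ℝ} {T m : ℕ} (hC : 4 * F ≤ C)
    (hC' : 2 * (2 * (1 + 2 * F) * (2 * N * (a 1 + K)) + 4 * (N * a 1)) * F ≤ C) (hm : 1 ≤ m) :
    nonuniqueSet n N a F R T ⊆ ⋃ k ∈ Finset.range (T * m + 1),
      reachingSet a F R (k / m) (nearDiscontinuity n N C (1 / m)) := by
  rintro z ⟨hz, T', hT', x, y, hx0, hy0, hx, hy, t, ht, hne⟩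
  obtain ⟨s, hs, hxy, hbr⟩ := exists_branching_point hF hx hy (hx0.trans hy0.symm) ht hne
  have hm0 : (0:ℝ) < m := by exact_mod_cast hm
  have hsm : 0 ≤ s * m := mul_nonneg hs.1 hm0.le
  have hfl := Nat.floor_le hsm
  have hlt := Nat.lt_floor_add_one (s * m)
  have hps : (⌊s * m⌋₊ : ℝ) / m ≤ s := (div_le_iff₀ hm0).2 hfl
  simp only [mem_iUnion]
  refine ⟨⌊s * m⌋₊, ?_, hz, x, hx0, hx.mono le_rfl (hps.trans hs.2.le), ?_⟩
  · rw [Finset.mem_range, Nat.lt_add_one_iff]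
    refine Nat.floor_le_of_le ?_
    push_cast
    gcongr
    exact hs.2.le.trans hT'
  · refine mem_nearDiscontinuity_of_branching ha_lip ha_nonneg ha_mono hF hC hC' hx hy hs hxy hbr
      ⟨by positivity, hps⟩ ?_ ((div_le_one hm0).2 (by exact_mod_cast hm))
    rw [sub_le_iff_le_add, ← add_div, le_div_iff₀ hm0]
    linarith

lemma volume_nonuniqueSet_eq_zero (hn : 1 ≤ n) (ha_lip : LipschitzOnWith K a (Set.Ici 0))
    (ha_nonneg : ∀ r : ℝ, 0 ≤ r → 0 ≤ a r) (ha_mono : MonotoneOn a (Set.Ici 0)) (hF : 0 < F)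
    (R : ℝ) (T : ℕ) : volume (nonuniqueSet n N a F R T) = 0 := by
  obtain ⟨C, hC1, hC2, hC3⟩ : ∃ C : ℝ, 1 ≤ C ∧ 4 * F ≤ C ∧
      2 * (2 * (1 + 2 * F) * (2 * N * (a 1 + K)) + 4 * (N * a 1)) * F ≤ C :=
    ⟨_, le_max_left _ _, (le_max_left _ _).trans (le_max_right _ _),
      (le_max_right _ _).trans (le_max_right _ _)⟩
  obtain ⟨c₁, hc₁, h₁⟩ := exists_volume_reachingSet_le n N ha_lip ha_nonneg ha_mono hF.le R T
  obtain ⟨c₂, hc₂, h₂⟩ := exists_volume_nearDiscontinuity_le N hn hC1 (R + F * T)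
  have hlim : Tendsto (fun m : ℕ => c₁ * c₂ * ENNReal.ofReal ((T + 1) / m)) atTop (nhds 0) := by
    have h := ENNReal.Tendsto.const_mul (a := c₁ * c₂)
      (ENNReal.tendsto_ofReal (tendsto_const_div_atTop_nhds_zero_nat ((T:ℝ) + 1)))
      (.inr (by finiteness))
    simpa using h
  refine le_antisymm (ge_of_tendsto hlim ?_) zero_le
  filter_upwards [eventually_ge_atTop 1, eventually_ge_atTop ⌈C⌉₊] with m hm hmC
  have hm0 : (1:ℝ) ≤ m := by exact_mod_cast hm
  have hCm : C * (1 / m) ≤ 1 := by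
    rw [mul_one_div, div_le_one (by positivity)]
    exact Nat.ceil_le.1 hmC
  have hk : ∀ k ∈ Finset.range (T * m + 1), volume (reachingSet a F R (k / m)
      (nearDiscontinuity n N C (1 / m))) ≤ c₁ * (c₂ * ENNReal.ofReal ((1 / m) ^ 2)) := by
    intro k hk
    refine (h₁ _ ⟨by positivity, ?_⟩ _).trans (by gcongr; exact h₂ _ (by positivity) hCm)
    rw [div_le_iff₀ (by positivity)]
    exact_mod_cast Nat.lt_add_one_iff.1 (Finset.mem_range.1 hk)
  calc _ ≤ _ := measure_mono (nonuniqueSet_subset ha_lip ha_nonneg ha_mono hF hC2 hC3 hm)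
    _ ≤ _ := measure_biUnion_finset_le _ _
    _ ≤ _ := Finset.sum_le_card_nsmul _ _ _ hk
    _ = c₁ * c₂ * ENNReal.ofReal (((T * m + 1 : ℕ) : ℝ) * (1 / m) ^ 2) := by
      rw [Finset.card_range, nsmul_eq_mul, ENNReal.ofReal_mul (by positivity),
        ENNReal.ofReal_natCast]
      ring
    _ ≤ _ := by
      gcongr
      push_cast
      rw [one_div_pow, mul_one_div, div_le_div_iff₀ (by positivity) (by positivity)]
      nlinarith

end Exceptional

/-- The set of initial data from which the metric bounded-confidence model admits
more than one Krasovsky solution has zero Lebesgue measure. -/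
theorem metric_krasovsky_ae_uniqueness (n N : ℕ) (hn : 1 ≤ n) (hN : 1 ≤ N)
    (a : ℝ → ℝ)
    (ha_lip : ∃ K : NNReal, LipschitzOnWith K a (Set.Ici 0))
    (ha_nonneg : ∀ r : ℝ, 0 ≤ r → 0 ≤ a r)
    (ha_pos : ∀ r : ℝ, 0 < r → 0 < a r)
    (ha_mono : MonotoneOn a (Set.Ici 0))
    :
    volume {xbar : St n N | ∃ T > (0:ℝ), ∃ x y : ℝ → St n N,
      x 0 = xbar ∧ y 0 = xbar ∧
      IsKrasovskySolutionOn (fm a) x (Set.Icc 0 T) ∧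
      IsKrasovskySolutionOn (fm a) y (Set.Icc 0 T) ∧
      ∃ t ∈ Set.Icc (0:ℝ) T, x t ≠ y t} = 0 := by
  obtain ⟨K, hK⟩ := ha_lip
  set F : ℝ := N * a 1 + 1 with hFdef
  have ha1 := ha_nonneg 1 zero_le_one
  have hF : 0 < F := by positivity
  have hbound : ∀ x : St n N, ∀ v ∈ krasovsky (fm a) x, ‖v‖ ≤ F := fun x v hv =>
    (norm_le_of_mem_krasovsky_fm ha_nonneg ha_mono hv).trans (by linarith)
  refine measure_mono_null (t := ⋃ R : ℕ, ⋃ T : ℕ, nonuniqueSet n N a F R T) ?_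
    (measure_iUnion_null fun R => measure_iUnion_null fun T =>
      volume_nonuniqueSet_eq_zero hn hK ha_nonneg ha_mono hF R T)
  rintro z ⟨T, hT, x, y, hx0, hy0, hx, hy, hne⟩
  obtain ⟨R, hR⟩ := exists_nat_ge ‖z‖
  obtain ⟨T₀, hT₀⟩ := exists_nat_ge T
  simp only [mem_iUnion]
  exact ⟨R, T₀, hR, T, hT₀, x, y, hx0, hy0, hx.isBoundedSol hbound hT.le,
    hy.isBoundedSol hbound hT.le, hne⟩
end
end

section
/- Let f : ℝ^m → ℝ^m be measurable and locally bounded, and suppose there exist pairwise disjoint sets M_α ⊆ ℝ^m (α in an index set A) with ⋃_α M_α = ℝ^m and M_α ⊆ closure(interior(M_α)) for every α, together with continuous functions f_α : ℝ^m → ℝ^m such that f(x) = f_α(x) for all x ∈ M_α. Then the set of Krasovsky solutions of ẋ = f(x) coincides with the set of Filippov solutions of ẋ = f(x). -/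
open MeasureTheory Set Filter
open scoped Pointwise

noncomputable section

/-- The Filippov multifunction of a vector field `g`:
`F g (x) = ⋂_{δ>0} ⋂_{S null} closure (convexHull (g '' (B(x,δ) \ S)))`. -/
def filippov {E : Type*} [NormedAddCommGroup E] [NormedSpace ℝ E] [MeasureSpace E]
    (g : E → E) (x : E) : Set E :=
  ⋂ δ > (0:ℝ), ⋂ S ∈ {S : Set E | volume S = 0},
    closure (convexHull ℝ (g '' (Metric.ball x δ \ S)))

/-- Filippov solution of `ẋ = g(x)` on the set `D`: an absolutely continuous curve
(written in integral form) whose a.e. derivative `v` satisfies `v(s) ∈ F g (x(s))`. -/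
def IsFilippovSolutionOn {E : Type*} [NormedAddCommGroup E] [NormedSpace ℝ E]
    [CompleteSpace E] [MeasureSpace E] (g : E → E) (x : ℝ → E) (D : Set ℝ) : Prop :=
  ∃ v : ℝ → E, LocallyIntegrableOn v D ∧
    (∀ t ∈ D, x t = x 0 + ∫ s in Ioc (0:ℝ) t, v s) ∧
    (∀ᵐ s ∂(volume.restrict D), v s ∈ filippov g (x s))

theorem filippov_subset_krasovsky {E : Type*} [NormedAddCommGroup E] [NormedSpace ℝ E]
    [MeasureSpace E] (g : E → E) (x : E) : filippov g x ⊆ krasovsky g x := by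
  intro v hv
  simp only [filippov, krasovsky, mem_iInter, mem_ofPred_eq] at hv ⊢
  intro δ hδ
  simpa using hv δ hδ ∅ measure_empty

/-- If every value of `g` on an open set is a limit of values of `g` outside any given null set,
then the Krasovsky multifunction is contained in the Filippov one. -/
theorem krasovsky_subset_filippov {E : Type*} [NormedAddCommGroup E] [NormedSpace ℝ E]
    [MeasureSpace E] {g : E → E}
    (hg : ∀ U S : Set E, IsOpen U → volume S = 0 → g '' U ⊆ closure (g '' (U \ S))) (x : E) :
    krasovsky g x ⊆ filippov g x := by
  refine subset_iInter₂ fun δ hδ => subset_iInter₂ fun S hS => ?_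
  refine (iInter₂_subset δ hδ).trans ?_
  refine closure_minimal (convexHull_min ?_ (convex_convexHull ℝ _).closure) isClosed_closure
  exact (hg _ S Metric.isOpen_ball hS).trans (closure_mono (subset_convexHull ℝ _))

/-- A function that is piecewise continuous on pieces contained in the closure of their interiors
takes, on an open set, only values that are limits of its values outside any given null set. -/
theorem image_subset_closure_image_diff_of_piecewise {X Y A : Type*} [TopologicalSpace X]
    [TopologicalSpace Y] [MeasurableSpace X] {μ : Measure X} [μ.IsOpenPosMeasure]
    {f : X → Y} {M : A → Set X} (h_cover : ⋃ α, M α = univ)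
    (h_dense : ∀ α, M α ⊆ closure (interior (M α)))
    {fα : A → X → Y} (h_cont : ∀ α, Continuous (fα α)) (h_eq : ∀ α, EqOn f (fα α) (M α))
    {U S : Set X} (hU : IsOpen U) (hS : μ S = 0) :
    f '' U ⊆ closure (f '' (U \ S)) := by
  rintro _ ⟨y, hyU, rfl⟩
  obtain ⟨α, hα⟩ := mem_iUnion.1 (h_cover ▸ mem_univ y)
  have hS' : Dense {z | z ∉ S} := Measure.dense_of_ae (measure_eq_zero_iff_ae_notMem.1 hS)
  have hy : y ∈ closure (U ∩ interior (M α) ∩ {z | z ∉ S}) :=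
    closure_minimal (hS'.open_subset_closure_inter (hU.inter isOpen_interior)) isClosed_closure
      (hU.inter_closure ⟨hyU, h_dense α hα⟩)
  rw [h_eq α hα]
  refine map_mem_closure (h_cont α) hy ?_
  rintro z ⟨⟨hzU, hzM⟩, hzS⟩
  exact ⟨z, ⟨hzU, hzS⟩, h_eq α (interior_subset hzM)⟩

/-- Hajek's lemma: if `f` is measurable, locally bounded, and piecewise continuous with
respect to a partition `(M α)` such that `M α ⊆ closure (interior (M α))`, then the
Krasovsky and Filippov solutions of `ẋ = f(x)` coincide. -/
theorem hajek_krasovsky_eq_filippov (m : ℕ) {A : Type*}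
    (f : EuclideanSpace ℝ (Fin m) → EuclideanSpace ℝ (Fin m))
    (hf_meas : Measurable f)
    (hf_bdd : ∀ x : EuclideanSpace ℝ (Fin m), ∃ r > (0:ℝ), ∃ C : ℝ,
      ∀ y ∈ Metric.ball x r, ‖f y‖ ≤ C)
    (M : A → Set (EuclideanSpace ℝ (Fin m)))
    (h_disj : ∀ α β, α ≠ β → Disjoint (M α) (M β))
    (h_cover : ⋃ α, M α = Set.univ)
    (h_dense : ∀ α, M α ⊆ closure (interior (M α)))
    (fα : A → EuclideanSpace ℝ (Fin m) → EuclideanSpace ℝ (Fin m))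
    (h_cont : ∀ α, Continuous (fα α))
    (h_eq : ∀ α, ∀ x ∈ M α, f x = fα α x) :
    ∀ (x : ℝ → EuclideanSpace ℝ (Fin m)) (D : Set ℝ),
      IsKrasovskySolutionOn f x D ↔ IsFilippovSolutionOn f x D := by
  intro x D
  have h : krasovsky f = filippov f := funext fun y =>
    (krasovsky_subset_filippov (fun _ _ hU hS =>
      image_subset_closure_image_diff_of_piecewise h_cover h_dense h_cont h_eq hU hS) y).antisymm
      (filippov_subset_krasovsky f y)
  simp only [IsKrasovskySolutionOn, IsFilippovSolutionOn, h]
end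
end

section
/- Let g : ℝ^m → ℝ^m be measurable and locally bounded. Then the Krasovsky multifunction K g and the Filippov multifunction F g are upper semicontinuous and, for every x ∈ ℝ^m, K g(x) and F g(x) are nonempty, compact, and convex subsets of ℝ^m. -/
open MeasureTheory Set Filter
open scoped Pointwise

noncomputable section

/-- The intersection of the closed convex hulls of the images under `f` of the members of `l`. -/
def limitHull {α E : Type*} [NormedAddCommGroup E] [NormedSpace ℝ E] (f : α → E)
    (l : Filter α) : Set E :=
  ⋂ s ∈ l, closure (convexHull ℝ (f '' s))

section LimitHull

variable {α E : Type*} [NormedAddCommGroup E] [NormedSpace ℝ E] {f : α → E} {l : Filter α}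

theorem limitHull_subset {s : Set α} (hs : s ∈ l) :
    limitHull f l ⊆ closure (convexHull ℝ (f '' s)) :=
  biInter_subset_of_mem hs

theorem isClosed_limitHull : IsClosed (limitHull f l) :=
  isClosed_biInter fun _ _ => isClosed_closure

theorem convex_limitHull : Convex ℝ (limitHull f l) :=
  convex_iInter₂ fun _ _ => (convex_convexHull ℝ _).closure

theorem isCompact_closure_convexHull_image [ProperSpace E] {s : Set α} {C : ℝ}
    (hs : ∀ a ∈ s, ‖f a‖ ≤ C) : IsCompact (closure (convexHull ℝ (f '' s))) := by
  refine Bornology.IsBounded.isCompact_closure (isBounded_convexHull.2 ?_)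
  refine isBounded_iff_forall_norm_le.2 ⟨C, ?_⟩
  rintro _ ⟨a, ha, rfl⟩
  exact hs a ha

theorem isCompact_limitHull [ProperSpace E] {C : ℝ} (h : ∀ᶠ a in l, ‖f a‖ ≤ C) :
    IsCompact (limitHull f l) :=
  (isCompact_closure_convexHull_image fun _ ha => ha).of_isClosed_subset
    isClosed_limitHull (limitHull_subset h)

theorem exists_closure_convexHull_image_subset [ProperSpace E] {C : ℝ}
    (h : ∀ᶠ a in l, ‖f a‖ ≤ C) {U : Set E} (hU : IsOpen U) (hlU : limitHull f l ⊆ U) :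
    ∃ s ∈ l, closure (convexHull ℝ (f '' s)) ⊆ U := by
  let V : {s // s ∈ l} → Set E :=
    fun s => closure (convexHull ℝ (f '' (s.1 ∩ {a | ‖f a‖ ≤ C})))
  have hV : Directed (· ⊇ ·) V := by
    intro s t
    refine ⟨⟨s.1 ∩ t.1, inter_mem s.2 t.2⟩, ?_, ?_⟩
    · exact closure_mono (convexHull_mono (image_mono
        (inter_subset_inter_left _ inter_subset_left)))
    · exact closure_mono (convexHull_mono (image_mono
        (inter_subset_inter_left _ inter_subset_right)))
  have : Nonempty {s // s ∈ l} := ⟨⟨univ, univ_mem⟩⟩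
  obtain ⟨s, hs⟩ := exists_subset_nhds_of_isCompact' (V := V) hV
    (fun s => isCompact_closure_convexHull_image fun _ ha => ha.2)
    (fun _ => isClosed_closure) (U := U) (fun x hx => hU.mem_nhds (hlU (by
      refine mem_iInter₂.2 fun s hs => ?_
      exact closure_mono (convexHull_mono (image_mono inter_subset_left))
        (mem_iInter.1 hx ⟨s, hs⟩))))
  exact ⟨_, inter_mem s.2 h, hs⟩

theorem nonempty_limitHull [ProperSpace E] [l.NeBot] {C : ℝ} (h : ∀ᶠ a in l, ‖f a‖ ≤ C) :
    (limitHull f l).Nonempty := by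
  by_contra hempty
  obtain ⟨s, hs, hsub⟩ := exists_closure_convexHull_image_subset h isOpen_empty
    (not_nonempty_iff_eq_empty.1 hempty).subset
  exact (((Filter.nonempty_of_mem hs).image f).convexHull (𝕜 := ℝ)).closure.ne_empty
    (subset_empty_iff.1 hsub)

theorem exists_limitHull_nhds_inf_subset [PseudoMetricSpace α] [ProperSpace E] {x : α} {C : ℝ}
    (h : ∀ᶠ a in nhds x ⊓ l, ‖f a‖ ≤ C) {ε : ℝ} (hε : 0 < ε) :
    ∃ δ > (0 : ℝ), ∀ y, dist x y < δ →
      limitHull f (nhds y ⊓ l) ⊆ limitHull f (nhds x ⊓ l) + Metric.ball (0 : E) ε := by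
  obtain ⟨s, hs, hsub⟩ := exists_closure_convexHull_image_subset h
    (Metric.isOpen_ball.add_left (s := limitHull f (nhds x ⊓ l)) (t := Metric.ball (0 : E) ε))
    (fun z hz => ⟨z, hz, 0, Metric.mem_ball_self hε, add_zero z⟩)
  obtain ⟨t, ht, u, hu, rfl⟩ := mem_inf_iff.1 hs
  obtain ⟨δ, hδ, hball⟩ := Metric.mem_nhds_iff.1 ht
  refine ⟨δ, hδ, fun y hy => (limitHull_subset (inter_mem_inf ?_ hu)).trans hsub⟩
  exact mem_of_superset (Metric.isOpen_ball.mem_nhds (Metric.mem_ball'.2 hy)) hball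

theorem krasovsky_eq_limitHull (g : E → E) (x : E) :
    krasovsky g x = limitHull g (nhds x ⊓ ⊤) := by
  rw [inf_top_eq]
  refine Subset.antisymm (subset_iInter₂ fun s hs => ?_) (subset_iInter₂ fun δ hδ => ?_)
  · obtain ⟨δ, hδ, hball⟩ := Metric.mem_nhds_iff.1 hs
    exact (biInter_subset_of_mem (x := δ) hδ).trans
      (closure_mono (convexHull_mono (image_mono hball)))
  · exact limitHull_subset (Metric.ball_mem_nhds x hδ)

theorem filippov_eq_limitHull [MeasureSpace E] (g : E → E) (x : E) :
    filippov g x = limitHull g (nhds x ⊓ ae volume) := by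
  refine Subset.antisymm (subset_iInter₂ fun s hs => ?_)
    (subset_iInter₂ fun δ hδ => subset_iInter₂ fun S hS => ?_)
  · obtain ⟨t, ht, u, hu, rfl⟩ := mem_inf_iff.1 hs
    obtain ⟨δ, hδ, hball⟩ := Metric.mem_nhds_iff.1 ht
    refine (biInter_subset_of_mem (x := δ) hδ).trans
      ((biInter_subset_of_mem (x := uᶜ) (mem_ae_iff.1 hu)).trans
        (closure_mono (convexHull_mono (image_mono ?_))))
    rw [sdiff_compl]
    exact inter_subset_inter_left u hball
  · exact limitHull_subset
      (inter_mem_inf (Metric.ball_mem_nhds x hδ) (compl_mem_ae_iff.2 hS))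

end LimitHull

theorem neBot_nhds_inf_ae {X : Type*} [TopologicalSpace X] [MeasurableSpace X] (μ : Measure X)
    [μ.IsOpenPosMeasure] (x : X) : (nhds x ⊓ ae μ).NeBot := by
  refine inf_neBot_iff.2 fun {s} hs {t} ht => ?_
  rw [inter_comm]
  exact (Measure.dense_of_ae ht).inter_nhds_nonempty hs


/-- For `g` measurable and locally bounded, the Krasovsky and Filippov multifunctions
are upper semicontinuous with nonempty, compact, convex values. -/
theorem krasovsky_filippov_usc_nonempty_compact_convex (m : ℕ)
    (g : EuclideanSpace ℝ (Fin m) → EuclideanSpace ℝ (Fin m))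
    (hg_meas : Measurable g)
    (hg_bdd : ∀ x : EuclideanSpace ℝ (Fin m), ∃ r > (0:ℝ), ∃ C : ℝ,
      ∀ y ∈ Metric.ball x r, ‖g y‖ ≤ C) :
    (∀ x : EuclideanSpace ℝ (Fin m), ∀ ε > (0:ℝ), ∃ δ > (0:ℝ),
      ∀ y : EuclideanSpace ℝ (Fin m), ‖x - y‖ < δ →
        krasovsky g y ⊆ krasovsky g x + Metric.ball (0 : EuclideanSpace ℝ (Fin m)) ε) ∧
    (∀ x : EuclideanSpace ℝ (Fin m), ∀ ε > (0:ℝ), ∃ δ > (0:ℝ),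
      ∀ y : EuclideanSpace ℝ (Fin m), ‖x - y‖ < δ →
        filippov g y ⊆ filippov g x + Metric.ball (0 : EuclideanSpace ℝ (Fin m)) ε) ∧
    (∀ x : EuclideanSpace ℝ (Fin m),
      (krasovsky g x).Nonempty ∧ IsCompact (krasovsky g x) ∧ Convex ℝ (krasovsky g x)) ∧
    (∀ x : EuclideanSpace ℝ (Fin m),
      (filippov g x).Nonempty ∧ IsCompact (filippov g x) ∧ Convex ℝ (filippov g x)) := by
  have bounded (l : Filter (EuclideanSpace ℝ (Fin m))) (x : EuclideanSpace ℝ (Fin m)) :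
      ∃ C : ℝ, ∀ᶠ a in nhds x ⊓ l, ‖g a‖ ≤ C := by
    obtain ⟨r, hr, C, hC⟩ := hg_bdd x
    exact ⟨C, mem_inf_of_left (mem_of_superset (Metric.ball_mem_nhds x hr) hC)⟩
  have usc (l : Filter (EuclideanSpace ℝ (Fin m))) (x : EuclideanSpace ℝ (Fin m)) (ε : ℝ)
      (hε : ε > 0) : ∃ δ > (0 : ℝ), ∀ y, ‖x - y‖ < δ → limitHull g (nhds y ⊓ l) ⊆
        limitHull g (nhds x ⊓ l) + Metric.ball (0 : EuclideanSpace ℝ (Fin m)) ε := by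
    obtain ⟨C, hC⟩ := bounded l x
    simpa only [dist_eq_norm] using exists_limitHull_nhds_inf_subset hC hε
  have values (l : Filter (EuclideanSpace ℝ (Fin m))) (x : EuclideanSpace ℝ (Fin m))
      (hl : (nhds x ⊓ l).NeBot) : (limitHull g (nhds x ⊓ l)).Nonempty ∧
        IsCompact (limitHull g (nhds x ⊓ l)) ∧ Convex ℝ (limitHull g (nhds x ⊓ l)) := by
    obtain ⟨C, hC⟩ := bounded l x
    exact ⟨nonempty_limitHull hC, isCompact_limitHull hC, convex_limitHull⟩
  simp only [krasovsky_eq_limitHull, filippov_eq_limitHull]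
  refine ⟨usc _, usc _, fun x => values _ x ?_, fun x => values _ x (neBot_nhds_inf_ae _ x)⟩
  rw [inf_top_eq]
  infer_instance
end
end

section
/- Along every Krasovsky solution x(·) of the metric bounded-confidence model ẋ = f^m(x) on [0, +∞), the average x_ave(t) = (1/N) Σ_{i=1}^N x_i(t) is constant in t. -/
open MeasureTheory Set Filter
open scoped Pointwise

noncomputable section

/-- If `g` takes values in the kernel of a continuous linear map, so does its Krasovsky
multifunction. -/
lemma krasovsky_subset_ker {E F : Type*} [NormedAddCommGroup E] [NormedSpace ℝ E]
    [NormedAddCommGroup F] [NormedSpace ℝ F] {g : E → E} (L : E →L[ℝ] F)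
    (hg : ∀ y, L (g y) = 0) (x : E) : krasovsky g x ⊆ LinearMap.ker L.toLinearMap := by
  refine (biInter_subset_of_mem (show (1 : ℝ) > 0 from one_pos)).trans ?_
  refine closure_minimal (convexHull_min ?_ (Submodule.convex _)) L.isClosed_ker
  rintro _ ⟨y, -, rfl⟩
  exact hg y

/-- A continuous linear map vanishing on the values of `g` is a first integral of the
Krasovsky solutions of `ẋ = g(x)`. -/
lemma IsKrasovskySolutionOn.map_eq {E F : Type*} [NormedAddCommGroup E] [NormedSpace ℝ E]
    [CompleteSpace E] [NormedAddCommGroup F] [NormedSpace ℝ F] [CompleteSpace F]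
    {g : E → E} {x : ℝ → E} (hx : IsKrasovskySolutionOn g x (Ici 0)) (L : E →L[ℝ] F)
    (hg : ∀ y, L (g y) = 0) {t : ℝ} (ht : 0 ≤ t) : L (x t) = L (x 0) := by
  obtain ⟨v, hv, hint, hae⟩ := hx
  have hvi : IntegrableOn v (Ioc 0 t) :=
    (hv.integrableOn_compact_subset Icc_subset_Ici_self isCompact_Icc).mono_set Ioc_subset_Icc_self
  have hsub : Ioc 0 t ⊆ Ici 0 := Ioc_subset_Icc_self.trans Icc_subset_Ici_self
  have hzero : ∫ s in Ioc 0 t, L (v s) = 0 :=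
    integral_eq_zero_of_ae <| (ae_restrict_of_ae_restrict_of_subset hsub hae).mono
      fun s hs => krasovsky_subset_ker L hg _ hs
  rw [hint t ht, map_add, ← L.integral_comp_comm hvi, hzero, add_zero]

/-- The pairwise interactions in the metric bounded-confidence model cancel. -/
lemma sum_fm_eq_zero {n N : ℕ} (a : ℝ → ℝ) (x : St n N) : ∑ i, fm a x i = 0 := by
  simp only [fm, Finset.sum_filter]
  have := IsAddTorsionFree.of_module_rat (EuclideanSpace ℝ (Fin n))
  rw [← self_eq_neg]
  conv_lhs => rw [Finset.sum_comm]
  simp_rw [← Finset.sum_neg_distrib]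
  refine Finset.sum_congr rfl fun i _ => Finset.sum_congr rfl fun j _ => ?_
  rw [norm_sub_rev (x i), ← neg_sub (x j), smul_neg]
  split_ifs <;> simp only [neg_zero]

/-- Along every Krasovsky solution of the metric bounded-confidence model, the
average opinion is constant in time. -/
theorem metric_krasovsky_average_preservation (n N : ℕ) (hn : 1 ≤ n) (hN : 1 ≤ N)
    (a : ℝ → ℝ)
    (ha_lip : ∃ K : NNReal, LipschitzOnWith K a (Set.Ici 0))
    (ha_nonneg : ∀ r : ℝ, 0 ≤ r → 0 ≤ a r)
    (ha_pos : ∀ r : ℝ, 0 < r → 0 < a r)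
    (ha_mono : MonotoneOn a (Set.Ici 0))
    (x : ℝ → St n N)
    (hx : IsKrasovskySolutionOn (fm a) x (Set.Ici 0)) :
    ∀ t ∈ Set.Ici (0:ℝ), (N:ℝ)⁻¹ • ∑ i, x t i = (N:ℝ)⁻¹ • ∑ i, x 0 i := by
  intro t ht
  have h := hx.map_eq (∑ i, ContinuousLinearMap.proj (R := ℝ) i)
    (fun y => by simpa using sum_fm_eq_zero a y) ht
  simp only [sum_apply, ContinuousLinearMap.proj_apply] at h
  rw [h]
end
end

section
/- Let κ ∈ {1,…,N−1} and let x(·) = (x_1(·),…,x_N(·)) be a Krasovsky solution of the topological bounded-confidence model ẋ = f^t(x), where a : [0,∞) → [0,∞) is continuous, nondecreasing and positive on (0,∞). Then for all 0 ≤ T¹ < T², the closed convex hull of {x_1(T²),…,x_N(T²)} is contained in the closed convex hull of {x_1(T¹),…,x_N(T¹)}. -/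
open MeasureTheory Set Filter
open scoped Pointwise

noncomputable section

/-- The set of the first `κ` elements of `{1,…,N} \ {i}` ordered by increasing distance
`‖x_j - x_i‖`, ties broken in favour of lower indices: `j` belongs to the set iff the
number of agents `k ≠ i` strictly preceding `j` in this order is `< κ`. -/
def topoNbrs {n N : ℕ} (κ : ℕ) (x : St n N) (i : Fin N) : Finset (Fin N) :=
  Finset.univ.filter fun j => j ≠ i ∧
    (Finset.univ.filter fun k => k ≠ i ∧
      (‖x k - x i‖ < ‖x j - x i‖ ∨ (‖x k - x i‖ = ‖x j - x i‖ ∧ k < j))).card < κ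

/-- The topological bounded-confidence vector field:
`fᵗᵢ(x) = Σ_{j ∈ Nᵢᵗ(x)} a(‖x_j - x_i‖)(x_j - x_i)`. -/
def ft {n N : ℕ} (a : ℝ → ℝ) (κ : ℕ) (x : St n N) : St n N :=
  fun i => ∑ j ∈ topoNbrs κ x i, a ‖x j - x i‖ • (x j - x i)

/-- A linear functional on the Krasovsky set inherits any continuous upper bound valid nearby. -/
theorem krasovsky_apply_le {E : Type*} [NormedAddCommGroup E] [NormedSpace ℝ E] {g : E → E}
    {x v : E} (hv : v ∈ krasovsky g x) (l : E →L[ℝ] ℝ) {h : E → ℝ} (hc : ContinuousAt h x)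
    (hb : ∀ᶠ y in nhds x, l (g y) ≤ h y) : l v ≤ h x := by
  refine le_of_forall_pos_le_add fun ε hε => ?_
  have h1 : ∀ᶠ y in nhds x, h y < h x + ε := hc.eventually_lt_const (by linarith)
  obtain ⟨δ, hδ, hball⟩ := Metric.eventually_nhds_iff_ball.1 (hb.and h1)
  have hmem : v ∈ closure (convexHull ℝ (g '' Metric.ball x δ)) := by
    simp only [krasovsky, mem_iInter] at hv
    exact hv δ hδ
  have hsub : closure (convexHull ℝ (g '' Metric.ball x δ)) ⊆ {w | l w ≤ h x + ε} := by
    refine closure_minimal (convexHull_min ?_ ?_) (isClosed_le l.continuous continuous_const)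
    · rintro _ ⟨y, hy, rfl⟩
      exact (hball y hy).1.trans (hball y hy).2.le
    · exact convex_halfSpace_le l.isLinear _
  exact hsub hmem

theorem posPart_le_integral {T t m : ℝ} {u w P : ℝ → ℝ} (hT : T ≤ t)
    (hu : ContinuousOn u (Icc T t)) (hw : IntervalIntegrable w volume T t)
    (hint : ∀ s ∈ Icc T t, u t - u s = ∫ r in s..t, w r)
    (hP0 : ∀ r, 0 ≤ P r) (hP : IntervalIntegrable P volume T t)
    (hb : ∀ᵐ r, r ∈ Ioc T t → m ≤ u r → w r ≤ P r) (h0 : u T ≤ m) :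
    max (u t - m) 0 ≤ ∫ r in T..t, P r := by
  refine max_le ?_ (intervalIntegral.integral_nonneg hT fun r _ => hP0 r)
  have hcpt : IsCompact (Icc T t ∩ u ⁻¹' Iic m) :=
    isCompact_Icc.of_isClosed_subset (hu.preimage_isClosed_of_isClosed isClosed_Icc isClosed_Iic)
      inter_subset_left
  obtain ⟨s, ⟨hs, hsm⟩, hmax⟩ := hcpt.exists_isGreatest ⟨T, left_mem_Icc.2 hT, h0⟩
  have hsub : uIcc s t ⊆ uIcc T t := by
    rw [uIcc_of_le hs.2, uIcc_of_le hT]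
    exact Icc_subset_Icc_left hs.1
  have h1 : ∫ r in s..t, w r ≤ ∫ r in s..t, P r := by
    refine intervalIntegral.integral_mono_ae_restrict hs.2 (hw.mono_set hsub)
      (hP.mono_set hsub) ?_
    rw [← restrict_Ioc_eq_restrict_Icc]
    refine (ae_restrict_iff' measurableSet_Ioc).2 ?_
    filter_upwards [hb] with r hr hrs
    have hrT : r ∈ Ioc T t := ⟨hs.1.trans_lt hrs.1, hrs.2⟩
    refine hr hrT ?_
    by_contra hlt
    exact absurd (hmax ⟨Ioc_subset_Icc_self hrT, (not_le.1 hlt).le⟩) (not_le.2 hrs.1)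
  have h2 : ∫ r in s..t, P r ≤ ∫ r in T..t, P r :=
    intervalIntegral.integral_mono_interval hs.1 hs.2 le_rfl
      (Eventually.of_forall hP0) hP
  have h3 := hint s hs
  have h4 : u s ≤ m := hsm
  linarith

/-- Integral form of Grönwall's inequality with zero initial value. -/
theorem nonpos_of_le_mul_integral {S T K : ℝ} {P : ℝ → ℝ} (hST : S ≤ T)
    (hP : ContinuousOn P (Icc S T)) (hP0 : ∀ r, 0 ≤ P r)
    (hb : ∀ t ∈ Icc S T, P t ≤ K * ∫ r in S..t, P r) : P T ≤ 0 := by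
  set F : ℝ → ℝ := IccExtend hST ((Icc S T).domRestrict P) with hF
  have hFc : Continuous F := (continuousOn_iff_continuous_domRestrict.1 hP).Icc_extend'
  have hFe : ∀ t ∈ Icc S T, F t = P t := fun t ht => by
    rw [hF, IccExtend_of_mem hST _ ht, domRestrict_apply]
  have hQe : ∀ t ∈ Icc S T, ∫ r in S..t, F r = ∫ r in S..t, P r := fun t ht => by
    refine intervalIntegral.integral_congr fun r hr => hFe r ?_
    rw [uIcc_of_le ht.1] at hr
    exact ⟨hr.1, hr.2.trans ht.2⟩
  have hd : ∀ t, HasDerivAt (fun t => ∫ r in S..t, F r) (F t) t := fun t =>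
    intervalIntegral.integral_hasDerivAt_right (hFc.intervalIntegrable _ _)
      hFc.stronglyMeasurable.stronglyMeasurableAtFilter hFc.continuousAt
  have hg := norm_le_gronwallBound_of_norm_deriv_right_le (f := fun t => ∫ r in S..t, F r)
    (f' := F) (δ := 0) (K := K) (ε := 0) (a := S) (b := T)
    (fun t _ => (hd t).continuousAt.continuousWithinAt)
    (fun t _ => (hd t).hasDerivWithinAt) (by simp) (fun t ht => by
      have ht' := Ico_subset_Icc_self ht
      rw [hQe t ht', hFe t ht', Real.norm_of_nonneg (hP0 t),
        Real.norm_of_nonneg (intervalIntegral.integral_nonneg ht.1 fun r _ => hP0 r), add_zero]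
      exact hb t ht') T (right_mem_Icc.2 hST)
  have hT := right_mem_Icc.2 hST
  simp only [gronwallBound_ε0_δ0, norm_le_zero_iff] at hg
  have := hb T hT
  rwa [← hQe T hT, hg, mul_zero] at this

theorem ft_apply_le {n N κ : ℕ} {a : ℝ → ℝ} (ha_nonneg : ∀ r : ℝ, 0 ≤ r → 0 ≤ a r)
    (ha_mono : MonotoneOn a (Ici 0)) {ρ : ℝ} {y : St n N} (hy : ‖y‖ ≤ ρ)
    (f : EuclideanSpace ℝ (Fin n) →L[ℝ] ℝ) (i : Fin N) :
    f (ft a κ y i) ≤ a (2 * ρ) * ∑ j, max (f (y j) - f (y i)) 0 := by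
  have hρ : 0 ≤ ρ := (norm_nonneg y).trans hy
  have hA : 0 ≤ a (2 * ρ) := ha_nonneg _ (by positivity)
  have hterm : ∀ j, a ‖y j - y i‖ * (f (y j) - f (y i)) ≤
      a (2 * ρ) * max (f (y j) - f (y i)) 0 := fun j => by
    have h1 : a ‖y j - y i‖ ≤ a (2 * ρ) := by
      refine ha_mono (norm_nonneg _) (mem_Ici.2 (by positivity)) ?_
      have := norm_sub_le (y j) (y i)
      have := norm_le_pi_norm y j
      have := norm_le_pi_norm y i
      linarith
    calc _ ≤ a ‖y j - y i‖ * max (f (y j) - f (y i)) 0 :=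
          mul_le_mul_of_nonneg_left (le_max_left _ _) (ha_nonneg _ (norm_nonneg _))
      _ ≤ _ := mul_le_mul_of_nonneg_right h1 (le_max_right _ _)
  simp only [ft, map_sum, map_smul, map_sub, smul_eq_mul, Finset.mul_sum]
  refine (Finset.sum_le_sum fun j _ => hterm j).trans ?_
  exact Finset.sum_le_sum_of_subset_of_nonneg (Finset.subset_univ _)
    fun j _ _ => mul_nonneg hA (le_max_right _ _)

/-- A closed half-space containing all agents at time `S` contains them at all later times. -/
theorem IsKrasovskySolutionOn.apply_le_of_apply_le {n N κ : ℕ} {a : ℝ → ℝ}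
    (ha_nonneg : ∀ r : ℝ, 0 ≤ r → 0 ≤ a r) (ha_mono : MonotoneOn a (Ici 0))
    {x : ℝ → St n N} (hx : IsKrasovskySolutionOn (ft a κ) x (Ici 0)) {S T m : ℝ}
    (hS : 0 ≤ S) (hST : S ≤ T) (f : EuclideanSpace ℝ (Fin n) →L[ℝ] ℝ)
    (hm : ∀ i, f (x S i) ≤ m) (i : Fin N) : f (x T i) ≤ m := by
  obtain ⟨v, hv, hxv, hvK⟩ := hx
  have hvi : ∀ s t, 0 ≤ s → s ≤ t → IntervalIntegrable v volume s t := fun s t hs hst => by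
    rw [intervalIntegrable_iff_integrableOn_Icc_of_le hst]
    exact hv.integrableOn_compact_subset (fun r hr => hs.trans hr.1) isCompact_Icc
  have hdiff : ∀ s t, 0 ≤ s → s ≤ t → x t - x s = ∫ r in s..t, v r := fun s t hs hst => by
    rw [hxv t (hs.trans hst), hxv s hs, ← intervalIntegral.integral_of_le hs,
      ← intervalIntegral.integral_of_le (hs.trans hst),
      ← intervalIntegral.integral_add_adjacent_intervals (hvi 0 s le_rfl hs) (hvi s t hs hst)]
    abel
  have hxc : ContinuousOn x (Icc S T) := by
    have h1 : ContinuousOn (fun t => x S + ∫ r in S..t, v r) (Icc S T) := by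
      have := intervalIntegral.continuousOn_primitive_interval'
        (hvi S T hS hST) (left_mem_uIcc)
      rw [uIcc_of_le hST] at this
      exact continuousOn_const.add this
    refine h1.congr fun t ht => ?_
    simp only [← hdiff S t hS ht.1, add_sub_cancel]
  obtain ⟨R, hR⟩ := isCompact_Icc.exists_bound_of_continuousOn hxc
  set A := a (2 * (R + 1))
  have hA : 0 ≤ A := by
    have := (norm_nonneg _).trans (hR S (left_mem_Icc.2 hST))
    exact ha_nonneg _ (by positivity)
  let l : Fin N → St n N →L[ℝ] ℝ := fun i => f.comp (ContinuousLinearMap.proj i)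
  have huc : ∀ i, ContinuousOn (fun t => f (x t i)) (Icc S T) := fun i =>
    (l i).continuous.comp_continuousOn hxc
  set P : ℝ → ℝ := fun t => ∑ j, max (f (x t j) - m) 0 with hPdef
  have hPc : ContinuousOn P (Icc S T) := continuousOn_finsetSum _ fun j _ =>
    ((huc j).sub continuousOn_const).sup continuousOn_const
  have hP0 : ∀ t, 0 ≤ P t := fun t => Finset.sum_nonneg fun j _ => le_max_right _ _
  have hvb : ∀ᵐ r, r ∈ Icc S T → ∀ i, m ≤ f (x r i) → f (v r i) ≤ A * P r := by
    filter_upwards [(ae_restrict_iff' measurableSet_Ici).1 hvK] with r hr hrI i hmi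
    have h1 : l i (v r) ≤ A * ∑ j, max (f (x r j) - f (x r i)) 0 := by
      refine krasovsky_apply_le (hr (hS.trans hrI.1)) (l i)
        (h := fun y => A * ∑ j, max (f (y j) - f (y i)) 0) (by fun_prop) ?_
      filter_upwards [Metric.ball_mem_nhds (x r) one_pos] with y hy
      refine ft_apply_le ha_nonneg ha_mono ?_ f i
      have := norm_le_norm_add_norm_sub' y (x r)
      rw [mem_ball_iff_norm] at hy
      linarith [hR r hrI]
    refine h1.trans (mul_le_mul_of_nonneg_left (Finset.sum_le_sum fun j _ => ?_) hA)
    exact max_le_max (by linarith) le_rfl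
  have hkey : ∀ t ∈ Icc S T, ∀ i, max (f (x t i) - m) 0 ≤ ∫ r in S..t, A * P r := by
    intro t ht i
    have hsub : Icc S t ⊆ Icc S T := Icc_subset_Icc_right ht.2
    have hvit := hvi S t hS ht.1
    refine posPart_le_integral (u := fun t => f (x t i)) (w := fun r => f (v r i)) ht.1
      ((huc i).mono hsub) ?_ ?_ (fun r => mul_nonneg hA (hP0 r)) ?_ ?_ (hm i)
    · exact ⟨(l i).integrable_comp hvit.1, (l i).integrable_comp hvit.2⟩
    · intro s hs
      have h1 := (l i).intervalIntegral_comp_comm (hvi s t (hS.trans hs.1) hs.2)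
      rw [← hdiff s t (hS.trans hs.1) hs.2, map_sub] at h1
      exact h1.symm
    · refine ContinuousOn.intervalIntegrable ?_
      rw [uIcc_of_le ht.1]
      exact (continuousOn_const.mul hPc).mono hsub
    · filter_upwards [hvb] with r hr hrI
      exact hr (hsub (Ioc_subset_Icc_self hrI)) i
  have hPT : P T ≤ 0 := by
    refine nonpos_of_le_mul_integral (K := N * A) hST hPc hP0 fun t ht => ?_
    calc P t ≤ ∑ _j : Fin N, ∫ r in S..t, A * P r := Finset.sum_le_sum fun j _ => hkey t ht j
      _ = N * A * ∫ r in S..t, P r := by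
        simp [intervalIntegral.integral_const_mul, mul_assoc]
  have h1 : max (f (x T i) - m) 0 ≤ P T :=
    Finset.single_le_sum (f := fun j => max (f (x T j) - m) 0)
      (fun j _ => le_max_right _ _) (Finset.mem_univ i)
  linarith [le_max_left (f (x T i) - m) 0]

/-- Contractivity of the support for Krasovsky solutions of the topological
bounded-confidence model. -/
theorem topological_krasovsky_support_contractivity (n N κ : ℕ) (hn : 1 ≤ n)
    (hN : 2 ≤ N) (hκ₁ : 1 ≤ κ) (hκ₂ : κ ≤ N - 1) (a : ℝ → ℝ)
    (ha_cont : ContinuousOn a (Set.Ici 0))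
    (ha_nonneg : ∀ r : ℝ, 0 ≤ r → 0 ≤ a r)
    (ha_pos : ∀ r : ℝ, 0 < r → 0 < a r)
    (ha_mono : MonotoneOn a (Set.Ici 0))
    (x : ℝ → St n N)
    (hx : IsKrasovskySolutionOn (ft a κ) x (Set.Ici 0)) :
    ∀ T₁ T₂ : ℝ, 0 ≤ T₁ → T₁ < T₂ →
      closure (convexHull ℝ (Set.range fun i => x T₂ i)) ⊆
        closure (convexHull ℝ (Set.range fun i => x T₁ i)) := by
  intro T₁ T₂ hT₁ hT
  refine closure_minimal (convexHull_min ?_ (convex_convexHull ℝ _).closure) isClosed_closure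
  rintro _ ⟨i, rfl⟩
  by_contra hi
  obtain ⟨f, m, hfm, hmf⟩ :=
    geometric_hahn_banach_closed_point (convex_convexHull ℝ _).closure isClosed_closure hi
  refine absurd (hx.apply_le_of_apply_le ha_nonneg ha_mono hT₁ hT.le f (m := m) (fun j => ?_) i)
    (not_le.2 hmf)
  exact (hfm _ (subset_closure (subset_convexHull ℝ _ ⟨j, rfl⟩))).le
end
end

section
/- Let N ≥ 2, n ≥ 1, let x_1,…,x_N ∈ ℝ^n, and for each i let Γ(i) be the smallest index j ≠ i minimizing ‖x_j − x_i‖. Consider the directed graph on {1,…,N} with edge set {(i, Γ(i)) : i}. Then every weakly connected component of this graph contains exactly one directed circuit, that circuit has length 2 (i.e., it consists of two nodes i, j with Γ(i) = j and Γ(j) = i), and the two nodes of the circuit are reachable by a directed path from every node of the component. -/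
open MeasureTheory Set Filter
open scoped Pointwise

noncomputable section

/-- `gamma x i` is the smallest index `j ≠ i` minimizing `‖x j - x i‖`
(with the junk value `i` in the degenerate case `N = 1`). -/
def gamma {n N : ℕ} (x : St n N) (i : Fin N) : Fin N :=
  if h : (Finset.univ.erase i).Nonempty then
    ((Finset.univ.erase i).filter
      (fun j => ‖x j - x i‖ = (Finset.univ.erase i).inf' h fun j => ‖x j - x i‖)).min'
      (by
        obtain ⟨j, hj, hjd⟩ := Finset.exists_mem_eq_inf' h (fun j => ‖x j - x i‖)
        exact ⟨j, Finset.mem_filter.mpr ⟨hj, hjd.symm⟩⟩)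
  else i

/-- The defining properties of `gamma`: `gamma x i` is a nearest neighbour of `i`, different from
`i`, and it is at most any other nearest neighbour. -/
lemma gamma_spec {n N : ℕ} (hN : 2 ≤ N) (x : St n N) (i : Fin N) :
    gamma x i ≠ i ∧ (∀ j, j ≠ i → ‖x (gamma x i) - x i‖ ≤ ‖x j - x i‖) ∧
      ∀ j, j ≠ i → ‖x j - x i‖ = ‖x (gamma x i) - x i‖ → gamma x i ≤ j := by
  have : Nontrivial (Fin N) := Fin.nontrivial_iff_two_le.mpr hN
  have h : (Finset.univ.erase i).Nonempty := by
    obtain ⟨j, hj⟩ := exists_ne i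
    exact ⟨j, by simp [hj]⟩
  have hne : ((Finset.univ.erase i).filter (fun j =>
      ‖x j - x i‖ = (Finset.univ.erase i).inf' h fun j => ‖x j - x i‖)).Nonempty := by
    obtain ⟨j, hj, hjd⟩ := Finset.exists_mem_eq_inf' h (fun j => ‖x j - x i‖)
    exact ⟨j, Finset.mem_filter.mpr ⟨hj, hjd.symm⟩⟩
  have hg : gamma x i = Finset.min' _ hne := by
    rw [gamma, dif_pos h]
  have hmem := Finset.min'_mem _ hne
  rw [← hg, Finset.mem_filter] at hmem
  refine ⟨Finset.ne_of_mem_erase hmem.1, fun j hj => ?_, fun j hj hd => ?_⟩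
  · rw [hmem.2]
    exact Finset.inf'_le (fun j => ‖x j - x i‖) (by simp [hj])
  · rw [hg]
    exact Finset.min'_le _ _ (Finset.mem_filter.mpr
      ⟨Finset.mem_erase.mpr ⟨hj, Finset.mem_univ j⟩, hd.trans hmem.2⟩)

/-- The distance to the nearest neighbour does not increase along an edge. -/
lemma norm_gamma_gamma_le {n N : ℕ} (hN : 2 ≤ N) (x : St n N) (i : Fin N) :
    ‖x (gamma x (gamma x i)) - x (gamma x i)‖ ≤ ‖x (gamma x i) - x i‖ :=
  ((gamma_spec hN x (gamma x i)).2.1 i (gamma_spec hN x i).1.symm).trans_eq (norm_sub_rev _ _)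

/-- Every directed circuit of the nearest neighbour graph has length two. -/
lemma gamma_gamma_of_isPeriodicPt {n N : ℕ} (hN : 2 ≤ N) (x : St n N) {u : Fin N} {p : ℕ}
    (hp : 0 < p) (hu : Function.IsPeriodicPt (gamma x) p u) : gamma x (gamma x u) = u := by
  have hanti : Antitone fun k => ‖x (gamma x ((gamma x)^[k] u)) - x ((gamma x)^[k] u)‖ :=
    antitone_nat_of_succ_le fun k => by
      rw [Function.iterate_succ_apply']
      exact norm_gamma_gamma_le hN x _
  obtain ⟨m, ⟨k, rfl⟩, hmin⟩ := WellFounded.has_min (wellFounded_lt (α := Fin N))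
    (Set.range fun k => (gamma x)^[k] u) (Set.range_nonempty _)
  have hle : ∀ l, (gamma x)^[k] u ≤ (gamma x)^[l] u := fun l => not_lt.mp (hmin _ ⟨l, rfl⟩)
  set w := (gamma x)^[k] u with hw
  have hper : (gamma x)^[k + p] u = w := by
    rw [Function.iterate_add_apply, hu.eq]
  have hd : ‖x (gamma x w) - x w‖ ≤ ‖x (gamma x (gamma x w)) - x (gamma x w)‖ := by
    have h := hanti (show k + 1 ≤ k + p by lia)
    simpa only [hper, Function.iterate_succ_apply', ← hw] using h
  have hww : gamma x (gamma x w) = w := by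
    refine le_antisymm ?_ ?_
    · refine (gamma_spec hN x (gamma x w)).2.2 w (gamma_spec hN x w).1.symm ?_
      rw [norm_sub_rev]
      exact le_antisymm hd (norm_gamma_gamma_le hN x w)
    · simpa only [Function.iterate_succ_apply', ← hw] using hle (k + 2)
  have hback : (gamma x)^[k * p - k] w = u := by
    rw [hw, ← Function.iterate_add_apply, Nat.sub_add_cancel (Nat.le_mul_of_pos_right k hp)]
    exact hu.const_mul k
  have hw2 : (gamma x)^[2] w = w := hww
  change (gamma x)^[2] u = u
  rw [← hback, ← Function.iterate_add_apply, add_comm, Function.iterate_add_apply, hw2]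

/-- A self-map of a finite type has a periodic point on every forward orbit. -/
lemma exists_isPeriodicPt_iterate {α : Type*} [Finite α] (f : α → α) (v : α) :
    ∃ k p, 0 < p ∧ Function.IsPeriodicPt f p (f^[k] v) := by
  obtain ⟨a, b, hab, h⟩ := Finite.exists_ne_map_eq_of_infinite fun k => f^[k] v
  wlog hlt : a < b generalizing a b
  · exact this b a hab.symm h.symm (by lia)
  refine ⟨a, b - a, by lia, ?_⟩
  rw [Function.IsPeriodicPt, Function.IsFixedPt, ← Function.iterate_add_apply,
    Nat.sub_add_cancel hlt.le]
  exact h.symm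

/-- The interaction graph of the topological model with `κ = 1` (edges `i → Γ(i)`)
is a directed pseudoforest: each weakly connected component contains exactly one
directed circuit, that circuit has length 2, and its two nodes are reachable by a
directed path from every node of the component. -/
theorem topological_one_neighbour_pseudoforest (n N : ℕ) (hN : 2 ≤ N) (x : St n N) :
    ∀ v : Fin N, ∃ i j : Fin N, i ≠ j ∧ gamma x i = j ∧ gamma x j = i ∧
      (∀ u : Fin N,
        Relation.ReflTransGen (fun p q => gamma x p = q ∨ gamma x q = p) u v →
          Relation.ReflTransGen (fun p q => gamma x p = q) u i) ∧
      (∀ u : Fin N,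
        Relation.ReflTransGen (fun p q => gamma x p = q ∨ gamma x q = p) u v →
          (∃ p : ℕ, 0 < p ∧ (gamma x)^[p] u = u) → u = i ∨ u = j) := by
  intro v
  obtain ⟨k, p, hp, hk⟩ := exists_isPeriodicPt_iterate (gamma x) v
  have hi := gamma_gamma_of_isPeriodicPt hN x hp hk
  set i := (gamma x)^[k] v with hi_def
  have hreach : ∀ u : Fin N,
      Relation.ReflTransGen (fun p q => gamma x p = q ∨ gamma x q = p) u v →
        ∃ m, (gamma x)^[m] u = i := by
    intro u hu
    induction hu using Relation.ReflTransGen.head_induction_on with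
    | refl => exact ⟨k, rfl⟩
    | head h _ ih =>
      obtain ⟨m, hm⟩ := ih
      rcases h with rfl | rfl
      · exact ⟨m + 1, hm⟩
      · refine ⟨m + 1, ?_⟩
        rw [← Function.iterate_succ_apply, Function.iterate_succ_apply',
          Function.iterate_succ_apply', hm, hi]
  refine ⟨i, gamma x i, (gamma_spec hN x i).1.symm, rfl, hi, fun u hu => ?_, ?_⟩
  · obtain ⟨m, hm⟩ := hreach u hu
    rw [← hm]
    clear hm
    induction m with
    | zero => exact .refl
    | succ m ih => exact ih.tail (Function.iterate_succ_apply' _ _ _).symm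
  · rintro u hu ⟨q, hq, huq⟩
    obtain ⟨m, hm⟩ := hreach u hu
    have huu : Function.IsPeriodicPt (gamma x) 2 u := gamma_gamma_of_isPeriodicPt hN x hq huq
    rw [← huu.iterate_mod_apply] at hm
    rcases Nat.mod_two_eq_zero_or_one m with h | h <;> rw [h] at hm
    · exact .inl hm
    · right
      rw [← hm]
      exact huu.eq.symm
end
end

section
/- Let κ = 1 and let x̄ ∈ (ℝ^n)^N satisfy f^t(x̄) = 0 (equivalently, x̄ is a Caratheodory equilibrium of the topological bounded-confidence model). Then x̄ is a cluster point: for every i ∈ {1,…,N}, x̄_i = x̄_{Γ(i)}, where Γ(i) is the smallest index j ≠ i minimizing ‖x̄_j − x̄_i‖; in particular, for every i there exists j ≠ i with x̄_j = x̄_i. -/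
open MeasureTheory Set Filter
open scoped Pointwise

noncomputable section

/-- The topological bounded-confidence vector field with `κ = 1` neighbour:
`fᵗᵢ(x) = a(‖x_{Γ(i)} - x_i‖)(x_{Γ(i)} - x_i)`. -/
def ft1 {n N : ℕ} (a : ℝ → ℝ) (x : St n N) : St n N :=
  fun i => a ‖x (gamma x i) - x i‖ • (x (gamma x i) - x i)

theorem gamma_ne {n N : ℕ} (hN : 2 ≤ N) (x : St n N) (i : Fin N) : gamma x i ≠ i := by
  have h : (Finset.univ.erase i).Nonempty :=
    Finset.card_pos.mp (by
      rw [Finset.card_erase_of_mem (Finset.mem_univ i), Finset.card_fin]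
      omega)
  rw [gamma, dif_pos h]
  exact Finset.ne_of_mem_erase (Finset.mem_filter.mp (Finset.min'_mem _ _)).1

theorem eq_gamma_of_ft1_eq_zero {n N : ℕ} {a : ℝ → ℝ} (ha : ∀ r : ℝ, 0 < r → 0 < a r)
    {x : St n N} {i : Fin N} (hi : ft1 a x i = 0) : x i = x (gamma x i) := by
  by_contra hne
  have hsub : x (gamma x i) - x i ≠ 0 := sub_ne_zero.mpr (Ne.symm hne)
  exact smul_ne_zero (ha _ (norm_pos_iff.mpr hsub)).ne' hsub hi

/-- For `κ = 1`, Caratheodory equilibria of the topological bounded-confidence model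
are cluster points. -/
theorem topological_caratheodory_equilibria_are_clusters (n N : ℕ) (hn : 1 ≤ n)
    (hN : 2 ≤ N) (a : ℝ → ℝ)
    (ha_lip : ∃ K : NNReal, LipschitzOnWith K a (Set.Ici 0))
    (ha_nonneg : ∀ r : ℝ, 0 ≤ r → 0 ≤ a r)
    (ha_pos : ∀ r : ℝ, 0 < r → 0 < a r)
    (ha_mono : MonotoneOn a (Set.Ici 0))
    (xbar : St n N) (heq : ft1 a xbar = 0) :
    (∀ i : Fin N, xbar i = xbar (gamma xbar i)) ∧
      ∀ i : Fin N, ∃ j : Fin N, j ≠ i ∧ xbar j = xbar i := by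
  have h (i : Fin N) : xbar i = xbar (gamma xbar i) :=
    eq_gamma_of_ft1_eq_zero ha_pos (congrFun heq i)
  exact ⟨h, fun i => ⟨gamma xbar i, gamma_ne hN xbar i, (h i).symm⟩⟩
end
end
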